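/- arXiv:2512.17670 — 2 statements merged into one kernel-verified Lean document; each statement's English description precedes it below -/
import Mathlib

section
/- Let Ω ⊂ ℝ^m be a bounded open set, θ ∈ (0, 1/4), φ : ℝ^m → ℝ a C^∞ function with |Dφ| ≤ 1 − 4θ on the closure of Ω, and Λ ≥ 0. Then there exists a constant C, depending only on m, Ω, φ, θ and Λ, such that every admissible solution u with source ρ (for these data) satisfies the energy estimate ∫_Ω w_u dx ≤ C (1 + ∫_Ω |ρ| dx). -/
open MeasureTheory Metric Set
open scoped ENNReal NNReal Topology

noncomputable section

/-- The tilt function `w_u = (1 - |Du|²)^{-1/2}`. -/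
noncomputable def tilt {m : ℕ} (u : EuclideanSpace ℝ (Fin m) → ℝ)
    (x : EuclideanSpace ℝ (Fin m)) : ℝ :=
  (Real.sqrt (1 - ‖gradient u x‖ ^ 2))⁻¹

/-- `div(w_u Du)(x) = Σ_i ∂_i (w_u ∂_i u)(x)`, the Lorentzian mean curvature of the
graph of `u` in Minkowski space. -/
noncomputable def lorentzMeanCurv {m : ℕ} (u : EuclideanSpace ℝ (Fin m) → ℝ)
    (x : EuclideanSpace ℝ (Fin m)) : ℝ :=
  ∑ i, gradient (fun y => tilt u y * (gradient u y) i) x i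

/-- `u` is an admissible solution with source `ρ` for the data `(Ω, φ, Λ)`:
`u` is `C^∞` on an open neighborhood of `closure Ω`, strictly spacelike on `closure Ω`,
equals `φ` on `∂Ω`, `ρ` is continuous on `Ω`, and
`|div(w_u Du) - ρ| ≤ Λ w_u` on `Ω`. -/
def IsAdmissible {m : ℕ} (Ω : Set (EuclideanSpace ℝ (Fin m)))
    (φ : EuclideanSpace ℝ (Fin m) → ℝ) (Λ : ℝ)
    (u ρ : EuclideanSpace ℝ (Fin m) → ℝ) : Prop :=
  (∃ V : Set (EuclideanSpace ℝ (Fin m)), IsOpen V ∧ closure Ω ⊆ V ∧ ContDiffOn ℝ (⊤ : ℕ∞) u V) ∧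
  (∀ x ∈ closure Ω, ‖gradient u x‖ < 1) ∧
  (∀ x ∈ frontier Ω, u x = φ x) ∧
  ContinuousOn ρ Ω ∧
  (∀ x ∈ Ω, |lorentzMeanCurv u x - ρ x| ≤ Λ * tilt u x)

theorem norm_sub_le_of_fderiv_closure {E : Type*} [NormedAddCommGroup E] [NormedSpace ℝ E]
    {s : Set E} {Ω : Set E} {f : E → ℝ} {L : ℝ}
    (hf : ∀ x ∈ closure Ω, DifferentiableAt ℝ f x) (hL : ∀ x ∈ closure Ω, ‖fderiv ℝ f x‖ ≤ L)
    (hs : Convex ℝ s) (hsΩ : s ⊆ closure Ω) {x y : E} (hx : x ∈ s) (hy : y ∈ s) :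
    ‖f y - f x‖ ≤ L * ‖y - x‖ :=
  hs.norm_image_sub_le_of_norm_fderiv_le (fun z hz => hf z (hsΩ hz))
    (fun z hz => hL z (hsΩ hz)) hx hy

/-- A function vanishing on the boundary is controlled by the distance to the complement. -/
theorem abs_le_mul_infDist_compl {E : Type*} [NormedAddCommGroup E] [NormedSpace ℝ E]
    [ProperSpace E] {Ω : Set E} (hΩ : IsOpen Ω) (hne : Ωᶜ.Nonempty) {f : E → ℝ} {L : ℝ}
    (hf : ∀ x ∈ closure Ω, DifferentiableAt ℝ f x) (hL : ∀ x ∈ closure Ω, ‖fderiv ℝ f x‖ ≤ L)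
    (hf0 : ∀ x ∈ frontier Ω, f x = 0) {x : E} (hx : x ∈ Ω) :
    |f x| ≤ L * infDist x Ωᶜ := by
  obtain ⟨z, hz, hxz⟩ := hΩ.isClosed_compl.exists_infDist_eq_dist hne x
  have hd : 0 < infDist x Ωᶜ :=
    (hΩ.isClosed_compl.notMem_iff_infDist_pos hne).1 (by simpa using hx)
  have hball : closedBall x (infDist x Ωᶜ) ⊆ closure Ω := by
    rw [← closure_ball x hd.ne']
    exact closure_mono ball_infDist_compl_subset
  have hzB : z ∈ closedBall x (infDist x Ωᶜ) := by
    rw [mem_closedBall, hxz, dist_comm]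
  have hzf : f z = 0 := hf0 z ⟨hball hzB, by rwa [hΩ.interior_eq]⟩
  have h := norm_sub_le_of_fderiv_closure hf hL (convex_closedBall _ _) hball hzB
    (mem_closedBall_self hd.le)
  rwa [hzf, sub_zero, Real.norm_eq_abs, ← dist_eq_norm, ← hxz] at h

theorem lipschitzWith_indicator_of_eq_zero_frontier {E : Type*} [NormedAddCommGroup E]
    [NormedSpace ℝ E] [ProperSpace E] {Ω : Set E} (hΩ : IsOpen Ω) (hne : Ωᶜ.Nonempty)
    {f : E → ℝ} {L : ℝ≥0} (hf : ∀ x ∈ closure Ω, DifferentiableAt ℝ f x)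
    (hL : ∀ x ∈ closure Ω, ‖fderiv ℝ f x‖ ≤ L) (hf0 : ∀ x ∈ frontier Ω, f x = 0) :
    LipschitzWith (2 * L) (Ω.indicator f) := by
  have key : ∀ x ∈ Ω, ∀ y, |Ω.indicator f x - Ω.indicator f y| ≤ 2 * L * dist x y := by
    intro x hx y
    have hxy := dist_nonneg (x := x) (y := y)
    have hLxy : 0 ≤ L * dist x y := by positivity
    have hfx := abs_le_mul_infDist_compl hΩ hne hf hL hf0 hx
    rw [indicator_of_mem hx]
    by_cases hy : y ∈ Ω
    · rw [indicator_of_mem hy]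
      have hfy := abs_le_mul_infDist_compl hΩ hne hf hL hf0 hy
      have near : ∀ z, closedBall z (dist x y) ⊆ Ω → x ∈ closedBall z (dist x y) →
          y ∈ closedBall z (dist x y) → |f x - f y| ≤ L * dist x y := by
        intro z hz hxz hyz
        have := norm_sub_le_of_fderiv_closure hf hL (convex_closedBall _ _)
          (hz.trans subset_closure) hyz hxz
        rwa [Real.norm_eq_abs, ← dist_eq_norm] at this
      rcases lt_or_ge (dist x y) (infDist x Ωᶜ) with h | h
      · have := near x ((closedBall_subset_ball h).trans ball_infDist_compl_subset)
          (mem_closedBall_self hxy) (by rw [mem_closedBall, dist_comm])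
        linarith
      rcases lt_or_ge (dist x y) (infDist y Ωᶜ) with h' | h'
      · have := near y ((closedBall_subset_ball h').trans ball_infDist_compl_subset)
          (by rw [mem_closedBall]) (mem_closedBall_self hxy)
        linarith
      have h1 := mul_le_mul_of_nonneg_left h L.2
      have h2 := mul_le_mul_of_nonneg_left h' L.2
      have := abs_sub (f x) (f y)
      simp only [NNReal.val_eq_coe] at h1 h2
      linarith
    · rw [indicator_of_notMem hy, sub_zero]
      have h1 := mul_le_mul_of_nonneg_left (infDist_le_dist_of_mem (x := x) (mem_compl hy)) L.2
      simp only [NNReal.val_eq_coe] at h1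
      linarith
  refine LipschitzWith.of_dist_le_mul fun x y => ?_
  rw [Real.dist_eq]
  push_cast
  by_cases hx : x ∈ Ω
  · exact key x hx y
  by_cases hy : y ∈ Ω
  · rw [abs_sub_comm, dist_comm]
    exact key y hy x
  · rw [indicator_of_notMem hx, indicator_of_notMem hy]
    simp only [sub_self, abs_zero]
    positivity

/-- The derivative of a Lipschitz function vanishes almost everywhere on its zero set. -/
theorem ae_fderiv_eq_zero_of_eq_zero_on {E : Type*} [NormedAddCommGroup E]
    [NormedSpace ℝ E] [FiniteDimensional ℝ E] [MeasurableSpace E] [BorelSpace E]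
    (μ : Measure E) [μ.IsAddHaarMeasure] {C : ℝ≥0} {g : E → ℝ} (hg : LipschitzWith C g)
    {s : Set E} (hs : MeasurableSet s) (h0 : ∀ x ∈ s, g x = 0) :
    ∀ᵐ x ∂μ, x ∈ s → fderiv ℝ g x = 0 := by
  rcases subsingleton_or_nontrivial E with hE | hE
  · exact Filter.Eventually.of_forall fun x _ => Subsingleton.elim _ _
  obtain ⟨e, he⟩ := exists_ne (0 : E)
  have hmeas : MeasurableSet (s ∩ {x | DifferentiableAt ℝ g x}) :=
    hs.inter (measurableSet_of_differentiableAt ℝ g)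
  have happ : ApproximatesLinearOn (fun x => g x • e) (0 : E →L[ℝ] E)
      (s ∩ {x | DifferentiableAt ℝ g x}) 0 := by
    intro x hx y hy
    simp [h0 x hx.1, h0 y hy.1]
  have h := happ.norm_fderiv_sub_le μ hmeas
    (fun x => (fderiv ℝ g x).smulRight e)
    (fun x hx => ((hx.2 : DifferentiableAt ℝ g x).hasFDerivAt.smul_const e).hasFDerivWithinAt)
  rw [ae_restrict_iff' hmeas] at h
  filter_upwards [h, hg.ae_differentiableAt (μ := μ)] with x hx hdx hxs
  have := hx ⟨hxs, hdx⟩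
  ext v
  have hz : fderiv ℝ g x = 0 := by simpa [he] using this
  rw [hz]

theorem setIntegral_fderiv_eq_zero {E : Type*} [NormedAddCommGroup E]
    [NormedSpace ℝ E] [FiniteDimensional ℝ E] [MeasurableSpace E] [BorelSpace E]
    (μ : Measure E) [μ.IsAddHaarMeasure] {Ω : Set E} (hΩ : IsOpen Ω)
    (hb : Bornology.IsBounded Ω) (hne : Ωᶜ.Nonempty) {f : E → ℝ}
    {L : ℝ≥0} (hf : ∀ x ∈ closure Ω, DifferentiableAt ℝ f x)
    (hL : ∀ x ∈ closure Ω, ‖fderiv ℝ f x‖ ≤ L) (hf0 : ∀ x ∈ frontier Ω, f x = 0) (e : E) :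
    ∫ x in Ω, fderiv ℝ f x e ∂μ = 0 := by
  have hlip := lipschitzWith_indicator_of_eq_zero_frontier hΩ hne hf hL hf0
  have hcs : HasCompactSupport (Ω.indicator f) :=
    HasCompactSupport.intro hb.isCompact_closure
      fun x hx => indicator_of_notMem (fun h => hx (subset_closure h)) f
  have hibp := (LipschitzWith.const (1 : ℝ) (α := E)).integral_lineDeriv_mul_eq (μ := μ)
    hlip hcs (-e)
  have hae : (fun x => lineDeriv ℝ (Ω.indicator f) x (- -e)) =ᵐ[μ]
      Ω.indicator (fun x => fderiv ℝ f x e) := by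
    filter_upwards [hlip.ae_differentiableAt (μ := μ), ae_fderiv_eq_zero_of_eq_zero_on μ hlip
      hΩ.measurableSet.compl (fun x hx => indicator_of_notMem hx f)] with x hdx hx0
    rw [neg_neg, hdx.lineDeriv_eq_fderiv]
    by_cases hx : x ∈ Ω
    · rw [indicator_of_mem hx]
      congr 1
      refine Filter.EventuallyEq.fderiv_eq ?_
      filter_upwards [hΩ.mem_nhds hx] with y hy using indicator_of_mem hy f
    · rw [hx0 hx, indicator_of_notMem hx]
      rfl
  rw [← integral_indicator hΩ.measurableSet, ← integral_congr_ae hae]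
  have h1 : ∀ x : E, lineDeriv ℝ (fun _ : E => (1 : ℝ)) x (-e) = 0 := fun x => by
    simp [lineDeriv]
  simpa [h1] using hibp.symm

theorem gradient_apply_eq_fderiv_single {m : ℕ} (f : EuclideanSpace ℝ (Fin m) → ℝ)
    (x : EuclideanSpace ℝ (Fin m)) (i : Fin m) :
    gradient f x i = fderiv ℝ f x (EuclideanSpace.single i 1) := by
  rw [← toDual_gradient, InnerProductSpace.toDual_apply_apply, EuclideanSpace.inner_single_right]
  simp

theorem contDiffOn_gradient {m : ℕ} {u : EuclideanSpace ℝ (Fin m) → ℝ}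
    {V : Set (EuclideanSpace ℝ (Fin m))} (hV : IsOpen V)
    (hu : ContDiffOn ℝ (⊤ : ℕ∞) u V) : ContDiffOn ℝ (⊤ : ℕ∞) (gradient u) V :=
  ((InnerProductSpace.toDual ℝ (EuclideanSpace ℝ (Fin m))).symm.contDiff).comp_contDiffOn
    (hu.fderiv_of_isOpen hV (by exact_mod_cast le_rfl))

theorem contDiffOn_tilt {m : ℕ} {u : EuclideanSpace ℝ (Fin m) → ℝ}
    {V : Set (EuclideanSpace ℝ (Fin m))} (hV : IsOpen V) (hu : ContDiffOn ℝ (⊤ : ℕ∞) u V)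
    (h1 : ∀ x ∈ V, ‖gradient u x‖ < 1) : ContDiffOn ℝ (⊤ : ℕ∞) (tilt u) V := by
  have hpos : ∀ x ∈ V, 0 < 1 - ‖gradient u x‖ ^ 2 := fun x hx => by
    nlinarith [h1 x hx, norm_nonneg (gradient u x)]
  exact ((contDiffOn_const.sub ((contDiffOn_gradient hV hu).norm_sq ℝ)).sqrt
    fun x hx => (hpos x hx).ne').inv fun x hx => (Real.sqrt_pos.2 (hpos x hx)).ne'

theorem integrableOn_of_contDiffOn_fderiv {m : ℕ} {f : EuclideanSpace ℝ (Fin m) → ℝ}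
    {V Ω : Set (EuclideanSpace ℝ (Fin m))} (hV : IsOpen V) (hb : Bornology.IsBounded Ω)
    (hΩV : closure Ω ⊆ V) (hf : ContDiffOn ℝ (⊤ : ℕ∞) f V) (e : EuclideanSpace ℝ (Fin m)) :
    IntegrableOn (fun x => fderiv ℝ f x e) Ω :=
  ((((hf.continuousOn_fderiv_of_isOpen hV (by simp)).clm_apply continuousOn_const).mono
    hΩV).integrableOn_compact hb.isCompact_closure).mono_set subset_closure

/-- The divergence theorem for a vector field vanishing on the boundary of an arbitrary bounded
open set. -/
theorem setIntegral_divergence_eq_zero {m : ℕ} {Ω V : Set (EuclideanSpace ℝ (Fin m))}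
    (hΩ : IsOpen Ω) (hb : Bornology.IsBounded Ω) (hne : Ωᶜ.Nonempty) (hV : IsOpen V)
    (hΩV : closure Ω ⊆ V) {G : Fin m → EuclideanSpace ℝ (Fin m) → ℝ}
    (hG : ∀ i, ContDiffOn ℝ (⊤ : ℕ∞) (G i) V) (hG0 : ∀ i, ∀ x ∈ frontier Ω, G i x = 0) :
    ∫ x in Ω, ∑ i, fderiv ℝ (G i) x (EuclideanSpace.single i 1) = 0 := by
  rw [integral_finsetSum _ fun i _ => integrableOn_of_contDiffOn_fderiv hV hb hΩV (hG i) _]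
  refine Finset.sum_eq_zero fun i _ => ?_
  obtain ⟨L, hL⟩ := hb.isCompact_closure.exists_bound_of_continuousOn
    (((hG i).continuousOn_fderiv_of_isOpen hV (by simp)).mono hΩV)
  exact setIntegral_fderiv_eq_zero volume hΩ hb hne (L := L.toNNReal)
    (fun x hx => ((hG i).contDiffAt (hV.mem_nhds (hΩV hx))).differentiableAt (by simp))
    (fun x hx => (hL x hx).trans (Real.le_coe_toNNReal L)) (hG0 i) _

theorem tilt_coercivity {θ s : ℝ} (hθ : θ ∈ Set.Ioo (0 : ℝ) (1 / 4)) (hs0 : 0 ≤ s) (hs1 : s < 1) :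
    θ * (√(1 - s ^ 2))⁻¹ - 2 / θ ≤ (√(1 - s ^ 2))⁻¹ * (s ^ 2 - s * (1 - 4 * θ)) := by
  obtain ⟨h0, h1⟩ := hθ
  have hw : 0 < (√(1 - s ^ 2))⁻¹ := inv_pos.2 (Real.sqrt_pos.2 (by nlinarith))
  rcases le_or_gt (1 - θ) s with h | h
  · have h2 : 0 < 2 / θ := by positivity
    have : θ ≤ s ^ 2 - s * (1 - 4 * θ) := by nlinarith
    nlinarith
  · have hle : (√(1 - s ^ 2))⁻¹ ≤ 1 / θ := by
      rw [one_div]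
      refine inv_anti₀ h0 (Real.le_sqrt_of_sq_le ?_)
      nlinarith
    have h3 : -1 ≤ s ^ 2 - s * (1 - 4 * θ) := by nlinarith
    have h4 : 2 / θ = 2 * (1 / θ) := by ring
    rw [h4]
    nlinarith

theorem tilt_mul_inner_ge {m : ℕ} {θ : ℝ} (hθ : θ ∈ Set.Ioo (0 : ℝ) (1 / 4))
    {u φ : EuclideanSpace ℝ (Fin m) → ℝ} {x : EuclideanSpace ℝ (Fin m)}
    (hu : ‖gradient u x‖ < 1) (hφ : ‖gradient φ x‖ ≤ 1 - 4 * θ) :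
    θ * tilt u x - 2 / θ ≤
      tilt u x * inner ℝ (gradient u x) (gradient u x - gradient φ x) := by
  have hw : 0 ≤ tilt u x := inv_nonneg.2 (Real.sqrt_nonneg _)
  refine (tilt_coercivity hθ (norm_nonneg _) hu).trans (mul_le_mul_of_nonneg_left ?_ hw)
  rw [inner_sub_right, real_inner_self_eq_norm_sq]
  have h1 := real_inner_le_norm (gradient u x) (gradient φ x)
  have h2 := mul_le_mul_of_nonneg_left hφ (norm_nonneg (gradient u x))
  linarith

/-- The divergence of `sinh (K (u - φ)) w_u Du`. -/
theorem divergence_sinh_mul_tilt_gradient {m : ℕ} {u φ : EuclideanSpace ℝ (Fin m) → ℝ} (K : ℝ)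
    {x : EuclideanSpace ℝ (Fin m)} (hu : DifferentiableAt ℝ u x) (hφ : DifferentiableAt ℝ φ x)
    (hF : ∀ i, DifferentiableAt ℝ (fun y => tilt u y * gradient u y i) x) :
    ∑ i, fderiv ℝ (fun y => Real.sinh (K * (u y - φ y)) * (tilt u y * gradient u y i)) x
        (EuclideanSpace.single i 1) =
      Real.sinh (K * (u x - φ x)) * lorentzMeanCurv u x +
        K * Real.cosh (K * (u x - φ x)) *
          (tilt u x * inner ℝ (gradient u x) (gradient u x - gradient φ x)) := by
  have hv := ((hu.hasFDerivAt.sub hφ.hasFDerivAt).const_mul K).sinh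
  have h : ∀ i, fderiv ℝ (fun y => Real.sinh (K * (u y - φ y)) * (tilt u y * gradient u y i)) x
      (EuclideanSpace.single i 1) =
      Real.sinh (K * (u x - φ x)) * gradient (fun y => tilt u y * gradient u y i) x i +
        K * Real.cosh (K * (u x - φ x)) *
          (tilt u x * (gradient u x i * (gradient u x i - gradient φ x i))) := by
    intro i
    have := (hv.mul (hF i).hasFDerivAt).fderiv
    simp only [Pi.mul_def, Pi.sub_apply] at this
    rw [this]
    simp only [gradient_apply_eq_fderiv_single, add_apply,
      smul_apply, sub_apply, smul_eq_mul]
    ring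
  simp_rw [h]
  rw [Finset.sum_add_distrib, ← Finset.mul_sum, ← Finset.mul_sum, ← Finset.mul_sum,
    lorentzMeanCurv, PiLp.inner_apply]
  congr 4
  ext i
  simp [mul_comm]

/-- The difference of an admissible solution and its boundary data is bounded a priori. -/
theorem exists_bound_sub_of_gradient_le {m : ℕ} {Ω : Set (EuclideanSpace ℝ (Fin m))}
    (hΩ : IsOpen Ω) (hb : Bornology.IsBounded Ω) (hne : Ωᶜ.Nonempty) :
    ∃ B : ℝ, ∀ u φ : EuclideanSpace ℝ (Fin m) → ℝ,
      (∀ x ∈ closure Ω, DifferentiableAt ℝ u x) → (∀ x ∈ closure Ω, DifferentiableAt ℝ φ x) →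
      (∀ x ∈ closure Ω, ‖gradient u x‖ ≤ 1) → (∀ x ∈ closure Ω, ‖gradient φ x‖ ≤ 1) →
      (∀ x ∈ frontier Ω, u x = φ x) → ∀ x ∈ Ω, |u x - φ x| ≤ B := by
  obtain ⟨z, hz⟩ := hne
  obtain ⟨r, hr⟩ := hb.subset_closedBall z
  refine ⟨2 * r, fun u φ hu hφ hu1 hφ1 h0 x hx => ?_⟩
  have hnorm : ∀ (f : EuclideanSpace ℝ (Fin m) → ℝ) y, ‖fderiv ℝ f y‖ = ‖gradient f y‖ :=
    fun f y => by rw [← toDual_gradient, LinearIsometryEquiv.norm_map]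
  have h := abs_le_mul_infDist_compl (f := fun y => u y - φ y) (L := 2) hΩ ⟨z, hz⟩
    (fun y hy => (hu y hy).sub (hφ y hy)) (fun y hy => ?_)
    (fun y hy => sub_eq_zero.2 (h0 y hy)) hx
  · have h1 := infDist_le_dist_of_mem (x := x) hz
    have h2 := mem_closedBall.1 (hr hx)
    linarith
  · rw [fderiv_fun_sub (hu y hy) (hφ y hy)]
    refine (norm_sub_le _ _).trans ?_
    rw [hnorm, hnorm]
    linarith [hu1 y hy, hφ1 y hy]

theorem energy_pointwise {θ Λ w H r c s E : ℝ} (hθ : 0 < θ)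
    (hc : 1 ≤ c) (hs : |s| ≤ c) (hw : 0 ≤ w) (hH : |H - r| ≤ Λ * w)
    (hE : θ * w - 2 / θ ≤ E) (hΛ : 0 ≤ Λ) :
    w - c * ((Λ + 1) / θ * (2 / θ) + |r|) ≤ s * H + (Λ + 1) / θ * c * E := by
  have h1 : |H| ≤ |r| + Λ * w := by
    have := abs_add_le (H - r) r
    rw [sub_add_cancel] at this
    linarith
  have h2 : -(c * (|r| + Λ * w)) ≤ s * H := by
    have h3 := neg_abs_le (s * H)
    rw [abs_mul] at h3
    have := mul_le_mul hs h1 (abs_nonneg H) (by linarith)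
    linarith
  have hK : 0 ≤ (Λ + 1) / θ * c := by positivity
  have h4 := mul_le_mul_of_nonneg_left hE hK
  have h5 : (Λ + 1) / θ * c * (θ * w - 2 / θ) =
      c * ((Λ + 1) * w) - c * ((Λ + 1) / θ * (2 / θ)) := by
    field_simp
  nlinarith [mul_nonneg (sub_nonneg.2 hc) hw]

/-- The energy (tilt function) estimate: `∫_Ω w_u ≤ C (1 + ∫_Ω |ρ|)` for every admissible
solution, with `C` depending only on `m, Ω, φ, θ, Λ`. -/
theorem energy_estimate {m : ℕ}
    (Ω : Set (EuclideanSpace ℝ (Fin m))) (hΩo : IsOpen Ω) (hΩb : Bornology.IsBounded Ω)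
    (θ : ℝ) (hθ : θ ∈ Set.Ioo (0 : ℝ) (1/4))
    (φ : EuclideanSpace ℝ (Fin m) → ℝ) (hφ : ContDiff ℝ (⊤ : ℕ∞) φ)
    (hφg : ∀ x ∈ closure Ω, ‖gradient φ x‖ ≤ 1 - 4 * θ)
    (Λ : ℝ) (hΛ : 0 ≤ Λ) :
    ∃ C : ℝ, 0 < C ∧
      ∀ u ρ : EuclideanSpace ℝ (Fin m) → ℝ, IsAdmissible Ω φ Λ u ρ →
        ∫⁻ x in Ω, ENNReal.ofReal (tilt u x)
          ≤ ENNReal.ofReal C * (1 + ∫⁻ x in Ω, ENNReal.ofReal |ρ x|) := by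
  rcases Ωᶜ.eq_empty_or_nonempty with hcompl | hne
  · rw [compl_empty_iff] at hcompl
    have hsub : Subsingleton (EuclideanSpace ℝ (Fin m)) := by
      by_contra h
      rw [not_subsingleton_iff_nontrivial] at h
      exact NormedSpace.unbounded_univ ℝ (EuclideanSpace ℝ (Fin m)) (hcompl ▸ hΩb)
    refine ⟨volume.real Ω + 1, by positivity, fun u ρ _ => ?_⟩
    have ht : ∀ x, tilt u x = 1 := fun x => by
      simp [tilt, Subsingleton.elim (gradient u x) 0]
    calc ∫⁻ x in Ω, ENNReal.ofReal (tilt u x) = volume Ω := by simp [ht]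
      _ = ENNReal.ofReal (volume.real Ω) := by
        rw [ofReal_measureReal hΩb.measure_lt_top.ne]
      _ ≤ ENNReal.ofReal (volume.real Ω + 1) := ENNReal.ofReal_le_ofReal (by linarith)
      _ ≤ _ := le_mul_of_one_le_right' (by simp)
  obtain ⟨B, hB⟩ := exists_bound_sub_of_gradient_le hΩo hΩb hne
  set K : ℝ := (Λ + 1) / θ with hK
  have hθ0 : 0 < θ := hθ.1
  have hKpos : 0 < K := by positivity
  set A : ℝ := Real.cosh (K * B) with hA
  have hApos : 0 < A := Real.cosh_pos _
  have hfin : volume Ω ≠ ∞ := hΩb.measure_lt_top.ne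
  have : IsFiniteMeasure (volume.restrict Ω) := ⟨by simpa using hΩb.measure_lt_top⟩
  refine ⟨A * (K * (2 / θ)) * volume.real Ω + A, by positivity, fun u ρ hadm => ?_⟩
  obtain ⟨⟨V₀, hV₀, hΩV₀, hu₀⟩, hu1, hbd, hρ, hH⟩ := hadm
  obtain ⟨V, hV, hΩV, hu, hV1⟩ : ∃ V, IsOpen V ∧ closure Ω ⊆ V ∧
      ContDiffOn ℝ (⊤ : ℕ∞) u V ∧ ∀ x ∈ V, ‖gradient u x‖ < 1 :=
    ⟨V₀ ∩ (fun x => ‖gradient u x‖) ⁻¹' Iio 1,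
      (contDiffOn_gradient hV₀ hu₀).continuousOn.norm.isOpen_inter_preimage hV₀ isOpen_Iio,
      fun x hx => ⟨hΩV₀ hx, hu1 x hx⟩, hu₀.mono inter_subset_left, fun x hx => hx.2⟩
  have hw := contDiffOn_tilt hV hu hV1
  have hF : ∀ i, ContDiffOn ℝ (⊤ : ℕ∞) (fun y => tilt u y * gradient u y i) V := fun i =>
    hw.mul (contDiffOn_euclidean.1 (contDiffOn_gradient hV hu) i)
  have hdiff : ∀ {f : EuclideanSpace ℝ (Fin m) → ℝ}, ContDiffOn ℝ (⊤ : ℕ∞) f V →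
      ∀ x ∈ closure Ω, DifferentiableAt ℝ f x := fun hf x hx =>
    (hf.contDiffAt (hV.mem_nhds (hΩV hx))).differentiableAt (by simp)
  have hG : ∀ i, ContDiffOn ℝ (⊤ : ℕ∞)
      (fun y => Real.sinh (K * (u y - φ y)) * (tilt u y * gradient u y i)) V := fun i =>
    (Real.contDiff_sinh.comp_contDiffOn
      (contDiffOn_const.mul (hu.sub hφ.contDiffOn))).mul (hF i)
  have hzero := setIntegral_divergence_eq_zero hΩo hΩb hne hV hΩV hG
    (fun i x hx => by simp [hbd x hx])
  have hGint : IntegrableOn (fun x => ∑ i,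
      fderiv ℝ (fun y => Real.sinh (K * (u y - φ y)) * (tilt u y * gradient u y i)) x
        (EuclideanSpace.single i 1)) Ω :=
    integrable_finsetSum _ fun i _ => integrableOn_of_contDiffOn_fderiv hV hΩb hΩV (hG i) _
  have hwint : IntegrableOn (tilt u) Ω :=
    ((hw.continuousOn.mono hΩV).integrableOn_compact hΩb.isCompact_closure).mono_set
      subset_closure
  have hHint : IntegrableOn (lorentzMeanCurv u) Ω := by
    refine integrable_finsetSum _ fun i _ => ?_
    refine (integrableOn_of_contDiffOn_fderiv hV hΩb hΩV (hF i)
      (EuclideanSpace.single i 1)).congr (Filter.Eventually.of_forall fun x => ?_)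
    exact (gradient_apply_eq_fderiv_single _ x i).symm
  have hρint : IntegrableOn ρ Ω := by
    refine (hHint.norm.add (hwint.const_mul Λ)).mono' (hρ.aestronglyMeasurable hΩo.measurableSet)
      ((ae_restrict_iff' hΩo.measurableSet).2 (Filter.Eventually.of_forall fun x hx => ?_))
    have h1 := abs_sub_abs_le_abs_sub (ρ x) (lorentzMeanCurv u x)
    rw [abs_sub_comm] at h1
    simp only [Pi.add_apply, Real.norm_eq_abs]
    linarith [hH x hx]
  have htilt : ∀ x, 0 ≤ tilt u x := fun x => inv_nonneg.2 (Real.sqrt_nonneg _)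
  have hrhs : IntegrableOn (fun x => A * (K * (2 / θ) + |ρ x|)) Ω :=
    ((integrable_const _).add hρint.abs).const_mul A
  have hmain : ∫ x in Ω, tilt u x ≤ ∫ x in Ω, ((∑ i,
      fderiv ℝ (fun y => Real.sinh (K * (u y - φ y)) * (tilt u y * gradient u y i)) x
        (EuclideanSpace.single i 1)) + A * (K * (2 / θ) + |ρ x|)) := by
    refine setIntegral_mono_on hwint (hGint.add hrhs) hΩo.measurableSet fun x hx => ?_
    have hxc := subset_closure hx
    rw [divergence_sinh_mul_tilt_gradient K (hdiff hu x hxc) (hdiff hφ.contDiffOn x hxc)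
      fun i => hdiff (hF i) x hxc]
    have hcosh : Real.cosh (K * (u x - φ x)) ≤ A := by
      rw [hA, Real.cosh_le_cosh, abs_mul, abs_mul]
      refine mul_le_mul_of_nonneg_left ((hB u φ (hdiff hu) (hdiff hφ.contDiffOn)
        (fun y hy => (hu1 y hy).le) (fun y hy => (hφg y hy).trans (by linarith))
        hbd x hx).trans (le_abs_self B)) (abs_nonneg _)
    have hsinh : |Real.sinh (K * (u x - φ x))| ≤ Real.cosh (K * (u x - φ x)) := by
      refine abs_le_of_sq_le_sq ?_ (Real.cosh_pos _).le
      rw [Real.cosh_sq]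
      linarith
    have hp := energy_pointwise hθ0 (Real.one_le_cosh _) hsinh (htilt x) (hH x hx)
      (tilt_mul_inner_ge hθ (hu1 x hxc) (hφg x hxc)) hΛ
    have hnn : 0 ≤ K * (2 / θ) + |ρ x| := by positivity
    have := mul_le_mul_of_nonneg_right hcosh hnn
    rw [← hK] at hp
    linarith
  rw [integral_add hGint hrhs, hzero, zero_add, integral_const_mul,
    integral_add (integrable_const _) hρint.abs, setIntegral_const, smul_eq_mul] at hmain
  have hρ0 : 0 ≤ ∫ x in Ω, |ρ x| := integral_nonneg fun x => abs_nonneg _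
  rw [← ofReal_integral_eq_lintegral_ofReal hwint (Filter.Eventually.of_forall htilt),
    ← ofReal_integral_eq_lintegral_ofReal hρint.abs
      (Filter.Eventually.of_forall fun x => abs_nonneg _),
    ← ENNReal.ofReal_one, ← ENNReal.ofReal_add zero_le_one hρ0,
    ← ENNReal.ofReal_mul (by positivity)]
  refine ENNReal.ofReal_le_ofReal (hmain.trans ?_)
  have : 0 ≤ A * (K * (2 / θ)) * volume.real Ω := by positivity
  nlinarith [mul_nonneg this hρ0]
end
end

section
/- Let m ≥ 2, let Ω ⊂ ℝ^m be a bounded open set, θ ∈ (0, 1/4), φ : ℝ^m → ℝ a C^∞ function with |Dφ| ≤ 1 − 4θ on the closure of Ω, and Λ ≥ 0. Let Ω′ be an open set with compact closure contained in Ω, and let ε > 0. Then there exists a constant C, depending only on m, Ω, φ, θ, Λ, Ω′ and ε, such that for every I₁, I₂ ≥ 0 and every admissible solution u with source ρ satisfying ∫_Ω |ρ| dx ≤ I₁ and (∫_{Ω′} ρ² dx)^{1/2} ≤ I₂, one has both ∫_{Ω′_ε} ( w_u |D²u|² + w_u³ |D²u · Du|² + w_u⁵ (D²u(Du, Du))²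 ) dx ≤ C (I₂² + I₁ + 1) and ∫_{Ω′_ε} |D ln w_u| dx ≤ C (I₂² + I₁ + 1). Here D²u denotes the Hessian of u, |D²u|² = Σ_{i,j} (∂_i∂_j u)², D²u·Du is the vector with components Σ_j (∂_i∂_j u)(∂_j u), and D²u(Du,Du) = Σ_{i,j} (∂_i∂_j u)(∂_i u)(∂_j u). -/
open MeasureTheory Metric Set
open scoped ENNReal NNReal Topology

noncomputable section

/-- Second partial derivative `∂_i ∂_j u (x)`. -/
noncomputable def hess {m : ℕ} (u : EuclideanSpace ℝ (Fin m) → ℝ)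
    (x : EuclideanSpace ℝ (Fin m)) (i j : Fin m) : ℝ :=
  gradient (fun y => (gradient u y) j) x i

/-- The partial derivative of `f` in the `i`-th coordinate direction. -/
def pd {m : ℕ} (i : Fin m) (f : EuclideanSpace ℝ (Fin m) → ℝ) (x : EuclideanSpace ℝ (Fin m)) : ℝ :=
  fderiv ℝ f x (EuclideanSpace.single i 1)

section PartialDerivatives

variable {m : ℕ} {f g : EuclideanSpace ℝ (Fin m) → ℝ} {x : EuclideanSpace ℝ (Fin m)}
  {s : Set (EuclideanSpace ℝ (Fin m))}

theorem gradient_apply_eq_pd (f : EuclideanSpace ℝ (Fin m) → ℝ) (x : EuclideanSpace ℝ (Fin m))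
    (i : Fin m) : gradient f x i = pd i f x := by
  have h := InnerProductSpace.toDual_symm_apply (𝕜 := ℝ) (x := EuclideanSpace.single i (1 : ℝ))
    (y := fderiv ℝ f x)
  rw [real_inner_comm, EuclideanSpace.inner_single_left] at h
  simpa [gradient, pd] using h

theorem norm_gradient (f : EuclideanSpace ℝ (Fin m) → ℝ) (x : EuclideanSpace ℝ (Fin m)) :
    ‖gradient f x‖ = ‖fderiv ℝ f x‖ := by
  simp [gradient]

theorem norm_gradient_sq (f : EuclideanSpace ℝ (Fin m) → ℝ) (x : EuclideanSpace ℝ (Fin m)) :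
    ‖gradient f x‖ ^ 2 = ∑ i, pd i f x ^ 2 := by
  simp [EuclideanSpace.real_norm_sq_eq, gradient_apply_eq_pd]

theorem pd_mul (i : Fin m) (hf : DifferentiableAt ℝ f x) (hg : DifferentiableAt ℝ g x) :
    pd i (fun y => f y * g y) x = pd i f x * g x + f x * pd i g x := by
  simp only [pd]
  rw [fderiv_fun_mul hf hg]
  simp
  ring

theorem pd_sub (i : Fin m) (hf : DifferentiableAt ℝ f x) (hg : DifferentiableAt ℝ g x) :
    pd i (fun y => f y - g y) x = pd i f x - pd i g x := by
  simp only [pd]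
  rw [fderiv_fun_sub hf hg]
  simp

theorem pd_sum {ι : Type*} (i : Fin m) (t : Finset ι) {F : ι → EuclideanSpace ℝ (Fin m) → ℝ}
    (hF : ∀ j ∈ t, DifferentiableAt ℝ (F j) x) :
    pd i (fun y => ∑ j ∈ t, F j y) x = ∑ j ∈ t, pd i (F j) x := by
  simp only [pd]
  rw [fderiv_fun_sum hF]
  simp

theorem pd_comp (i : Fin m) {h : ℝ → ℝ} {h' : ℝ} (hh : HasDerivAt h h' (f x))
    (hf : DifferentiableAt ℝ f x) : pd i (fun y => h (f y)) x = h' * pd i f x := by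
  have := hh.comp_hasFDerivAt x hf.hasFDerivAt
  simp only [pd]
  rw [show (fun y => h (f y)) = h ∘ f from rfl, this.fderiv]
  simp

theorem pd_congr_of_eqOn (i : Fin m) (hs : IsOpen s) (hx : x ∈ s) (h : Set.EqOn f g s) :
    pd i f x = pd i g x := by
  simp only [pd]
  rw [(h.eventuallyEq_of_mem (hs.mem_nhds hx)).fderiv_eq]

theorem contDiffOn_pd (i : Fin m) (hs : IsOpen s) {n k : ℕ∞} (hf : ContDiffOn ℝ n f s)
    (hk : k + 1 ≤ n) : ContDiffOn ℝ k (pd i f) s := by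
  have h := hf.fderiv_of_isOpen (m := k) hs (by exact_mod_cast hk)
  exact h.clm_apply contDiffOn_const

theorem contDiffOn_pd_infty (i : Fin m) (hs : IsOpen s) (hf : ContDiffOn ℝ (⊤ : ℕ∞) f s) :
    ContDiffOn ℝ (⊤ : ℕ∞) (pd i f) s :=
  contDiffOn_pd i hs hf le_top

theorem pd_pd_comm (i j : Fin m) (hf : ContDiffAt ℝ 2 f x) :
    pd i (pd j f) x = pd j (pd i f) x := by
  have h := (hf.isSymmSndFDerivAt (by simp)).eq (EuclideanSpace.single i 1)
    (EuclideanSpace.single j 1)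
  have hd : DifferentiableAt ℝ (fderiv ℝ f) x :=
    (hf.fderiv_right (m := 1) (by norm_num)).differentiableAt (by norm_num)
  have key : ∀ a b : Fin m, pd a (pd b f) x =
      fderiv ℝ (fderiv ℝ f) x (EuclideanSpace.single a 1) (EuclideanSpace.single b 1) := by
    intro a b
    change fderiv ℝ (fun y => fderiv ℝ f y (EuclideanSpace.single b 1)) x _ = _
    rw [fderiv_clm_apply hd (differentiableAt_const _)]
    simp
  rw [key, key, h]

/-- The divergence theorem for `C¹` vector fields vanishing off a compact subset of an open set. -/
theorem integral_divergence_eq_zero {Ω K : Set (EuclideanSpace ℝ (Fin m))} (hΩ : IsOpen Ω)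
    (hK : IsCompact K) (hKΩ : K ⊆ Ω) {X : Fin m → EuclideanSpace ℝ (Fin m) → ℝ}
    (hX : ∀ i, ContDiffOn ℝ 1 (X i) Ω) (hX0 : ∀ i, ∀ x ∈ Ω \ K, X i x = 0) :
    IntegrableOn (fun x => ∑ i, pd i (X i) x) Ω ∧ ∫ x in Ω, ∑ i, pd i (X i) x = 0 := by
  have key : ∀ i, IntegrableOn (pd i (X i)) Ω ∧ ∫ x in Ω, pd i (X i) x = 0 := by
    intro i
    set F := Ω.indicator (X i) with hF
    have hF0 : ∀ x ∉ K, F x = 0 := by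
      intro x hx
      by_cases hxΩ : x ∈ Ω
      · rw [hF, Set.indicator_of_mem hxΩ]
        exact hX0 i x ⟨hxΩ, hx⟩
      · exact Set.indicator_of_notMem hxΩ _
    have hsupp : HasCompactSupport F := HasCompactSupport.intro hK hF0
    have hFd : ContDiff ℝ 1 F := by
      rw [contDiff_iff_contDiffAt]
      intro x
      by_cases hx : x ∈ K
      · have hn := hΩ.mem_nhds (hKΩ hx)
        refine ((hX i).contDiffAt hn).congr_of_eventuallyEq ?_
        filter_upwards [hn] with y hy using Set.indicator_of_mem hy _
      · refine (contDiffAt_const (c := (0 : ℝ))).congr_of_eventuallyEq ?_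
        filter_upwards [hK.isClosed.isOpen_compl.mem_nhds hx] with y hy using hF0 y hy
    have hcont : Continuous (pd i F) :=
      (hFd.continuous_fderiv (by norm_num)).clm_apply continuous_const
    have hcs : HasCompactSupport (pd i F) := hsupp.fderiv_apply (𝕜 := ℝ) _
    have hint : Integrable (pd i F) := hcont.integrable_of_hasCompactSupport hcs
    have hzero : ∫ x, pd i F x = 0 := by
      have := integral_mul_fderiv_eq_neg_fderiv_mul_of_integrable (μ := volume) (f := fun _ => (1 : ℝ))
        (g := F) (v := EuclideanSpace.single i 1) (by simp)
        (by simp only [one_mul]; exact hint)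
        (by simpa using hFd.continuous.integrable_of_hasCompactSupport hsupp)
        (fun x _ => differentiableAt_const _)
        (fun x _ => hFd.differentiable (by norm_num) x)
      simpa [pd] using this
    have heq : Set.EqOn (pd i F) (pd i (X i)) Ω := fun x hx =>
      pd_congr_of_eqOn i hΩ hx fun y hy => Set.indicator_of_mem hy _
    refine ⟨hint.integrableOn.congr_fun heq hΩ.measurableSet, ?_⟩
    rw [← setIntegral_congr_fun hΩ.measurableSet heq, setIntegral_eq_integral_of_forall_compl_eq_zero,
      hzero]
    intro x hx
    have hxK : x ∉ K := fun h => hx (hKΩ h)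
    have := pd_congr_of_eqOn (f := F) (g := fun _ => 0) i hK.isClosed.isOpen_compl hxK
      (fun y hy => hF0 y hy)
    rw [this]
    simp [pd]
  refine ⟨integrable_finsetSum _ fun i _ => (key i).1, ?_⟩
  rw [integral_finsetSum _ fun i _ => (key i).1]
  exact Finset.sum_eq_zero fun i _ => (key i).2

end PartialDerivatives

/-- If `D` has vanishing integral and `a ≤ D + b`, then `∫ a ≤ ∫ b`. -/
theorem lintegral_le_of_le_add_of_integral_eq_zero {α : Type*} [MeasurableSpace α] {μ : Measure α}
    {D a b : α → ℝ} (hD : Integrable D μ) (hD0 : ∫ x, D x ∂μ = 0)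
    (ha : ∀ᵐ x ∂μ, 0 ≤ a x) (hb : ∀ᵐ x ∂μ, 0 ≤ b x) (hab : ∀ᵐ x ∂μ, a x ≤ D x + b x) :
    ∫⁻ x, ENNReal.ofReal (a x) ∂μ ≤ ∫⁻ x, ENNReal.ofReal (b x) ∂μ := by
  have h1 : ∫⁻ x, ENNReal.ofReal (D x) ∂μ = ∫⁻ x, ENNReal.ofReal (-D x) ∂μ := by
    have := integral_eq_lintegral_pos_part_sub_lintegral_neg_part hD
    rw [hD0, eq_comm, sub_eq_zero] at this
    exact (ENNReal.toReal_eq_toReal_iff' hD.lintegral_lt_top.ne hD.neg.lintegral_lt_top.ne).1 this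
  have hfin : ∫⁻ x, ENNReal.ofReal (-D x) ∂μ ≠ ∞ := hD.neg.lintegral_lt_top.ne
  have hm : AEMeasurable (fun x => ENNReal.ofReal (D x)) μ := hD.aemeasurable.ennreal_ofReal
  have hm' : AEMeasurable (fun x => ENNReal.ofReal (-D x)) μ := hD.neg.aemeasurable.ennreal_ofReal
  have h2 : ∫⁻ x, ENNReal.ofReal (a x) ∂μ + ∫⁻ x, ENNReal.ofReal (-D x) ∂μ ≤
      ∫⁻ x, ENNReal.ofReal (b x) ∂μ + ∫⁻ x, ENNReal.ofReal (-D x) ∂μ := by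
    nth_rewrite 2 [← h1]
    rw [← lintegral_add_right' _ hm, ← lintegral_add_right' _ hm']
    refine lintegral_mono_ae ?_
    filter_upwards [ha, hb, hab] with x hax hbx habx
    rcases le_total 0 (D x) with h | h
    · rw [ENNReal.ofReal_of_nonpos (neg_nonpos.2 h), add_zero, ← ENNReal.ofReal_add hbx h]
      exact ENNReal.ofReal_le_ofReal (by linarith)
    · rw [ENNReal.ofReal_of_nonpos h, add_zero, ← ENNReal.ofReal_add hax (neg_nonneg.2 h)]
      exact ENNReal.ofReal_le_ofReal (by linarith)
  exact (ENNReal.add_le_add_iff_right hfin).1 h2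

section Tilt

variable {m : ℕ} {u : EuclideanSpace ℝ (Fin m) → ℝ} {x : EuclideanSpace ℝ (Fin m)}
  {s : Set (EuclideanSpace ℝ (Fin m))}

theorem hess_eq_pd_pd (u : EuclideanSpace ℝ (Fin m) → ℝ) (x : EuclideanSpace ℝ (Fin m))
    (i j : Fin m) : hess u x i j = pd i (pd j u) x := by
  rw [hess, gradient_apply_eq_pd]
  simp only [gradient_apply_eq_pd]

theorem one_sub_norm_gradient_sq_pos (h : ‖gradient u x‖ < 1) : 0 < 1 - ‖gradient u x‖ ^ 2 := by
  nlinarith [norm_nonneg (gradient u x)]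

theorem tilt_pos (h : ‖gradient u x‖ < 1) : 0 < tilt u x :=
  inv_pos.2 (Real.sqrt_pos.2 (one_sub_norm_gradient_sq_pos h))

theorem tilt_nonneg (u : EuclideanSpace ℝ (Fin m) → ℝ) (x : EuclideanSpace ℝ (Fin m)) :
    0 ≤ tilt u x :=
  inv_nonneg.2 (Real.sqrt_nonneg _)

theorem tilt_sq_mul (h : ‖gradient u x‖ < 1) :
    tilt u x ^ 2 * (1 - ‖gradient u x‖ ^ 2) = 1 := by
  have h0 := one_sub_norm_gradient_sq_pos h
  rw [tilt, inv_pow, Real.sq_sqrt h0.le, inv_mul_cancel₀ h0.ne']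

theorem one_le_tilt (h : ‖gradient u x‖ < 1) : 1 ≤ tilt u x := by
  have h1 := tilt_sq_mul h
  have h2 := tilt_pos h
  by_contra! h3
  have : tilt u x ^ 2 < 1 := by nlinarith
  nlinarith [sq_nonneg ‖gradient u x‖, one_sub_norm_gradient_sq_pos h, sq_nonneg (tilt u x)]

theorem contDiffOn_tilt_s5 (hs : IsOpen s) (hu : ContDiffOn ℝ (⊤ : ℕ∞) u s)
    (hlt : ∀ y ∈ s, ‖gradient u y‖ < 1) : ContDiffOn ℝ (⊤ : ℕ∞) (tilt u) s := by
  have heq : tilt u = fun y => (Real.sqrt (1 - ∑ i, pd i u y ^ 2))⁻¹ := by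
    funext y
    rw [tilt, norm_gradient_sq]
  have hpos : ∀ y ∈ s, 0 < 1 - ∑ i, pd i u y ^ 2 := fun y hy => by
    rw [← norm_gradient_sq]
    exact one_sub_norm_gradient_sq_pos (hlt y hy)
  rw [heq]
  refine ContDiffOn.inv (ContDiffOn.sqrt ?_ fun y hy => (hpos y hy).ne')
    fun y hy => (Real.sqrt_pos.2 (hpos y hy)).ne'
  exact contDiffOn_const.sub (ContDiffOn.sum fun i _ => (contDiffOn_pd_infty i hs hu).pow 2)

theorem differentiableAt_of_contDiffOn {f : EuclideanSpace ℝ (Fin m) → ℝ} (hs : IsOpen s)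
    (hf : ContDiffOn ℝ (⊤ : ℕ∞) f s) (hx : x ∈ s) : DifferentiableAt ℝ f x :=
  (hf.contDiffAt (hs.mem_nhds hx)).differentiableAt (by simp)

theorem contDiffAt_two_of_contDiffOn {f : EuclideanSpace ℝ (Fin m) → ℝ} (hs : IsOpen s)
    (hf : ContDiffOn ℝ (⊤ : ℕ∞) f s) (hx : x ∈ s) : ContDiffAt ℝ 2 f x :=
  (hf.contDiffAt (hs.mem_nhds hx)).of_le
    (show ((2 : ℕ∞) : WithTop ℕ∞) ≤ _ from WithTop.coe_le_coe.2 le_top)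

theorem pd_tilt (hs : IsOpen s) (hu : ContDiffOn ℝ (⊤ : ℕ∞) u s)
    (hlt : ∀ y ∈ s, ‖gradient u y‖ < 1) (hx : x ∈ s) (k : Fin m) :
    pd k (tilt u) x = tilt u x ^ 3 * ∑ j, pd k (pd j u) x * pd j u x := by
  have heq : tilt u = fun y => (Real.sqrt (1 - ∑ i, pd i u y * pd i u y))⁻¹ := by
    funext y
    rw [tilt, norm_gradient_sq]
    simp only [sq]
  have hpos : 0 < 1 - ∑ i, pd i u x * pd i u x := by
    have := one_sub_norm_gradient_sq_pos (hlt x hx)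
    rw [norm_gradient_sq] at this
    simpa only [sq] using this
  have hd : ∀ i, DifferentiableAt ℝ (pd i u) x := fun i =>
    differentiableAt_of_contDiffOn hs (contDiffOn_pd_infty i hs hu) hx
  have hd' : DifferentiableAt ℝ (fun y => ∑ i, pd i u y * pd i u y) x :=
    DifferentiableAt.fun_sum fun i _ => (hd i).fun_mul (hd i)
  have hder := ((Real.hasDerivAt_sqrt hpos.ne').inv (Real.sqrt_pos.2 hpos).ne')
  rw [heq, pd_comp k (f := fun y => 1 - ∑ i, pd i u y * pd i u y) (h := fun t => (Real.sqrt t)⁻¹)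
    hder ((differentiableAt_const _).sub hd'), pd_sub k (differentiableAt_const _) hd',
    pd_sum k _ fun i _ => (hd i).fun_mul (hd i)]
  have h0 : pd k (fun _ => (1 : ℝ)) x = 0 := by simp [pd]
  have h1 : ∑ i, pd k (fun y => pd i u y * pd i u y) x = 2 * ∑ j, pd k (pd j u) x * pd j u x := by
    rw [Finset.mul_sum]
    refine Finset.sum_congr rfl fun i _ => ?_
    rw [pd_mul k (hd i) (hd i)]
    ring
  have h2 := (Real.sqrt_pos.2 hpos).ne'
  rw [h0, h1]
  field_simp
  ring

theorem lorentzMeanCurv_eq (hs : IsOpen s) (hu : ContDiffOn ℝ (⊤ : ℕ∞) u s)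
    (hlt : ∀ y ∈ s, ‖gradient u y‖ < 1) (hx : x ∈ s) :
    lorentzMeanCurv u x = tilt u x ^ 3 * (∑ i, ∑ j, pd i (pd j u) x * pd i u x * pd j u x)
      + tilt u x * ∑ i, pd i (pd i u) x := by
  have hw := differentiableAt_of_contDiffOn hs (contDiffOn_tilt_s5 hs hu hlt) hx
  have hd : ∀ i, DifferentiableAt ℝ (pd i u) x := fun i =>
    differentiableAt_of_contDiffOn hs (contDiffOn_pd_infty i hs hu) hx
  simp only [lorentzMeanCurv, gradient_apply_eq_pd]
  rw [Finset.mul_sum, Finset.mul_sum, ← Finset.sum_add_distrib]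
  refine Finset.sum_congr rfl fun i _ => ?_
  rw [pd_mul i hw (hd i), pd_tilt hs hu hlt hx, mul_assoc, Finset.sum_mul]
  congr 2
  exact Finset.sum_congr rfl fun j _ => by ring

theorem norm_gradient_log_tilt_sq (hs : IsOpen s) (hu : ContDiffOn ℝ (⊤ : ℕ∞) u s)
    (hlt : ∀ y ∈ s, ‖gradient u y‖ < 1) (hx : x ∈ s) :
    ‖gradient (fun y => Real.log (tilt u y)) x‖ ^ 2 =
      tilt u x ^ 4 * ∑ i, (∑ j, pd i (pd j u) x * pd j u x) ^ 2 := by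
  have hw := differentiableAt_of_contDiffOn hs (contDiffOn_tilt_s5 hs hu hlt) hx
  have h0 := (tilt_pos (hlt x hx)).ne'
  rw [norm_gradient_sq, Finset.mul_sum]
  refine Finset.sum_congr rfl fun i _ => ?_
  rw [pd_comp i (Real.hasDerivAt_log h0) hw, pd_tilt hs hu hlt hx]
  field_simp

/-- The `k`-th component of `D²u · Du - (Δu) Du`. -/
def hessField (u : EuclideanSpace ℝ (Fin m) → ℝ) (k : Fin m) (x : EuclideanSpace ℝ (Fin m)) : ℝ :=
  (∑ j, pd j (pd k u) x * pd j u x) - pd k u x * ∑ j, pd j (pd j u) x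

theorem contDiffOn_hessField (hs : IsOpen s) (hu : ContDiffOn ℝ (⊤ : ℕ∞) u s) (k : Fin m) :
    ContDiffOn ℝ (⊤ : ℕ∞) (hessField u k) s := by
  have h1 := fun i => contDiffOn_pd_infty i hs hu
  have h2 := fun i j => contDiffOn_pd_infty j hs (h1 i)
  exact (ContDiffOn.sum fun j _ => (h2 k j).mul (h1 j)).sub
    ((h1 k).mul (ContDiffOn.sum fun j _ => h2 j j))

/-- `div(D²u · Du - (Δu) Du) = |D²u|² - (Δu)²`. -/
theorem sum_pd_hessField (hs : IsOpen s) (hu : ContDiffOn ℝ (⊤ : ℕ∞) u s) (hx : x ∈ s) :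
    ∑ k, pd k (hessField u k) x =
      (∑ i, ∑ j, pd i (pd j u) x ^ 2) - (∑ i, pd i (pd i u) x) ^ 2 := by
  have h1 := fun i => contDiffOn_pd_infty i hs hu
  have h2 := fun i j => contDiffOn_pd_infty j hs (h1 i)
  have d1 := fun i => differentiableAt_of_contDiffOn hs (h1 i) hx
  have d2 := fun i j => differentiableAt_of_contDiffOn hs (h2 i j) hx
  have c1 : ∀ i, ContDiffAt ℝ 2 (pd i u) x := fun i =>
    contDiffAt_two_of_contDiffOn hs (h1 i) hx
  have c0 : ContDiffAt ℝ 2 u x := contDiffAt_two_of_contDiffOn hs hu hx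
  have hk : ∀ k, pd k (hessField u k) x =
      (∑ j, (pd j (pd k (pd k u)) x * pd j u x + pd k (pd j u) x ^ 2))
      - (pd k (pd k u) x * ∑ j, pd j (pd j u) x
        + pd k u x * ∑ j, pd k (pd j (pd j u)) x) := by
    intro k
    unfold hessField
    rw [pd_sub k (DifferentiableAt.fun_sum fun j _ => (d2 k j).fun_mul (d1 j))
      ((d1 k).fun_mul (DifferentiableAt.fun_sum fun j _ => d2 j j)),
      pd_sum k _ fun j _ => (d2 k j).fun_mul (d1 j),
      pd_mul k (d1 k) (DifferentiableAt.fun_sum fun j _ => d2 j j), pd_sum k _ fun j _ => d2 j j]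
    congr 1
    refine Finset.sum_congr rfl fun j _ => ?_
    rw [pd_mul k (d2 k j) (d1 j), pd_pd_comm k j (c1 k), pd_pd_comm j k c0, sq]
  simp only [hk, Finset.sum_sub_distrib, Finset.sum_add_distrib]
  rw [← Finset.sum_mul]
  have h3 : ∑ k, ∑ j, pd j (pd k (pd k u)) x * pd j u x =
      ∑ k, pd k u x * ∑ j, pd k (pd j (pd j u)) x := by
    rw [Finset.sum_comm]
    refine Finset.sum_congr rfl fun k _ => ?_
    rw [Finset.mul_sum]
    exact Finset.sum_congr rfl fun j _ => mul_comm _ _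
  rw [h3]
  ring

theorem sum_pd_weighted_hessField (hs : IsOpen s) (hu : ContDiffOn ℝ (⊤ : ℕ∞) u s)
    (hlt : ∀ y ∈ s, ‖gradient u y‖ < 1) {ζ : EuclideanSpace ℝ (Fin m) → ℝ}
    (hζ : DifferentiableAt ℝ ζ x) (hx : x ∈ s) :
    ∑ k, pd k (fun y => ζ y * ζ y * (tilt u y * hessField u k y)) x =
      ζ x ^ 2 * (tilt u x * (∑ i, ∑ j, pd i (pd j u) x ^ 2)
        + tilt u x ^ 3 * (∑ i, (∑ j, pd i (pd j u) x * pd j u x) ^ 2)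
        - lorentzMeanCurv u x * ∑ i, pd i (pd i u) x)
      + 2 * ζ x * tilt u x * ∑ k, pd k ζ x * hessField u k x := by
  have hw := differentiableAt_of_contDiffOn hs (contDiffOn_tilt_s5 hs hu hlt) hx
  have hY := fun k => differentiableAt_of_contDiffOn hs (contDiffOn_hessField hs hu k) hx
  have c0 : ContDiffAt ℝ 2 u x := contDiffAt_two_of_contDiffOn hs hu hx
  have hk : ∀ k, pd k (fun y => ζ y * ζ y * (tilt u y * hessField u k y)) x =
      2 * ζ x * tilt u x * (pd k ζ x * hessField u k x)
        + ζ x ^ 2 * tilt u x ^ 3 * ((∑ j, pd k (pd j u) x * pd j u x) * hessField u k x)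
        + ζ x ^ 2 * tilt u x * pd k (hessField u k) x := by
    intro k
    rw [pd_mul k (hζ.fun_mul hζ) (hw.fun_mul (hY k)), pd_mul k hζ hζ, pd_mul k hw (hY k),
      pd_tilt hs hu hlt hx]
    ring
  have hg : ∀ k, hessField u k x = (∑ j, pd k (pd j u) x * pd j u x)
      - pd k u x * ∑ j, pd j (pd j u) x := by
    intro k
    simp only [hessField, pd_pd_comm _ k c0]
  have h4 : ∑ k, (∑ j, pd k (pd j u) x * pd j u x) * hessField u k x =
      (∑ i, (∑ j, pd i (pd j u) x * pd j u x) ^ 2)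
        - (∑ i, ∑ j, pd i (pd j u) x * pd i u x * pd j u x) * ∑ j, pd j (pd j u) x := by
    rw [Finset.sum_mul, ← Finset.sum_sub_distrib]
    refine Finset.sum_congr rfl fun k _ => ?_
    have : ∑ j, pd k (pd j u) x * pd k u x * pd j u x =
        (∑ j, pd k (pd j u) x * pd j u x) * pd k u x := by
      rw [Finset.sum_mul]
      exact Finset.sum_congr rfl fun j _ => by ring
    rw [hg, this]
    ring
  simp only [hk, Finset.sum_add_distrib, ← Finset.mul_sum]
  rw [h4, sum_pd_hessField hs hu hx, lorentzMeanCurv_eq hs hu hlt hx]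
  ring

end Tilt

section PointwiseEstimates

theorem two_mul_le_mul_sq_add_sq_div {c : ℝ} (hc : 0 < c) (a b : ℝ) :
    2 * (a * b) ≤ c * a ^ 2 + b ^ 2 / c := by
  have h : c * a ^ 2 + b ^ 2 / c - 2 * (a * b) = (c * a - b) ^ 2 / c := by
    field_simp
    ring
  have : 0 ≤ (c * a - b) ^ 2 / c := by positivity
  linarith

theorem absorption_inequality {w M L S G T H ρ Λ Z ζ : ℝ} (hw : 1 ≤ w) (hM : 1 ≤ M) (hL : 0 < L)
    (hS : 0 ≤ S) (hG : 0 ≤ G) (hT : T ^ 2 ≤ M * S) (hH : |H - ρ| ≤ Λ * w)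
    (hZ : Z ^ 2 ≤ L ^ 2 * (2 * (G + T ^ 2))) (hζ0 : 0 ≤ ζ) (hζ1 : ζ ≤ 1) :
    ζ ^ 2 / 2 * (w * S + w ^ 3 * G) ≤
      (ζ ^ 2 * (w * S + w ^ 3 * G - H * T) + 2 * ζ * w * Z)
        + (2 * M * ρ ^ 2 + (2 * M * Λ ^ 2 + 8 * M * L ^ 2) * w) := by
  have hw0 : 0 < w := by linarith
  have hM0 : 0 < M := by linarith
  have hTS : T ^ 2 / M ≤ S := by rw [div_le_iff₀ hM0]; linarith
  have hζ2 : ζ ^ 2 ≤ 1 := by nlinarith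
  have hSw : S ≤ w * S := by nlinarith
  have hGw : w * G ≤ w ^ 3 * G := by
    refine mul_le_mul_of_nonneg_right ?_ hG
    nlinarith [mul_nonneg hw0.le (by nlinarith : 0 ≤ w ^ 2 - 1)]
  have h1 : ρ * T ≤ w * S / 8 + 2 * M * ρ ^ 2 := by
    have := two_mul_le_mul_sq_add_sq_div (c := 4 * M) (by positivity) ρ T
    have e : T ^ 2 / (4 * M) = T ^ 2 / M / 4 := by field_simp
    rw [e] at this
    linarith
  have h2 : (H - ρ) * T ≤ w * S / 8 + 2 * M * Λ ^ 2 * w := by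
    obtain ⟨e, he⟩ : ∃ e, H - ρ = w * e := ⟨(H - ρ) / w, by field_simp⟩
    rw [he, abs_mul, abs_of_pos hw0, mul_comm] at hH
    have hle : |e| ≤ Λ := le_of_mul_le_mul_right hH hw0
    have he2 : e ^ 2 ≤ Λ ^ 2 := sq_le_sq.2 (hle.trans (le_abs_self _))
    have := two_mul_le_mul_sq_add_sq_div (c := 4 * M) (by positivity) e T
    have e' : T ^ 2 / (4 * M) = T ^ 2 / M / 4 := by field_simp
    rw [e'] at this
    have h3 : e * T ≤ S / 8 + 2 * M * Λ ^ 2 := by nlinarith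
    rw [he]
    nlinarith
  have h3 : -(2 * ζ * w * Z) ≤ ζ ^ 2 * (w * G + w * S) / 4 + 8 * M * L ^ 2 * w := by
    have := two_mul_le_mul_sq_add_sq_div (c := 8 * M * L ^ 2) (by positivity) 1 (-(ζ * Z))
    have hle : (-(ζ * Z)) ^ 2 / (8 * M * L ^ 2) ≤ ζ ^ 2 * (G + S) / 4 := by
      rw [div_le_iff₀ (by positivity)]
      have hGM : G ≤ M * G := by nlinarith
      have hz : Z ^ 2 ≤ L ^ 2 * (2 * (M * G + M * S)) :=
        hZ.trans (mul_le_mul_of_nonneg_left (by linarith) (sq_nonneg L))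
      calc (-(ζ * Z)) ^ 2 = ζ ^ 2 * Z ^ 2 := by ring
        _ ≤ ζ ^ 2 * (L ^ 2 * (2 * (M * G + M * S))) :=
          mul_le_mul_of_nonneg_left hz (sq_nonneg ζ)
        _ = _ := by ring
    nlinarith
  have h4 : H * T ≤ w * S / 4 + 2 * M * ρ ^ 2 + 2 * M * Λ ^ 2 * w := by linarith
  have h5 : ζ ^ 2 * (H * T) ≤ ζ ^ 2 * (w * S / 4) + (2 * M * ρ ^ 2 + 2 * M * Λ ^ 2 * w) := by
    have p : 0 ≤ 2 * M * ρ ^ 2 + 2 * M * Λ ^ 2 * w := by positivity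
    nlinarith [mul_le_mul_of_nonneg_left h4 (sq_nonneg ζ)]
  have h6 := mul_le_mul_of_nonneg_left hGw (sq_nonneg ζ)
  have h7 : 0 ≤ ζ ^ 2 * (w ^ 3 * G) := by positivity
  nlinarith

theorem fifth_power_term_le {w M S Q T H ρ Λ : ℝ} (hw : 1 ≤ w) (hT : T ^ 2 ≤ M * S)
    (hH : |H - ρ| ≤ Λ * w) (hHQ : H = w ^ 3 * Q + w * T) :
    w ^ 5 * Q ^ 2 ≤ 3 * M * (w * S) + 3 * ρ ^ 2 + 3 * Λ ^ 2 * w := by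
  have hw0 : 0 < w := by linarith
  have h1 : (H - ρ) ^ 2 ≤ (Λ * w) ^ 2 := sq_le_sq.2 (hH.trans (le_abs_self _))
  have h2 : (w ^ 3 * Q) ^ 2 ≤ 3 * (ρ ^ 2 + (H - ρ) ^ 2 + (w * T) ^ 2) := by
    have : w ^ 3 * Q = ρ + (H - ρ) - w * T := by linarith
    rw [this]
    nlinarith [sq_nonneg (ρ - (H - ρ)), sq_nonneg (ρ + w * T), sq_nonneg ((H - ρ) + w * T)]
  have h3 : ρ ^ 2 ≤ w * ρ ^ 2 := by nlinarith [sq_nonneg ρ]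
  have h4 : (w * T) ^ 2 ≤ w * (M * (w * S)) := by
    nlinarith [mul_le_mul_of_nonneg_left hT (sq_nonneg w)]
  refine le_of_mul_le_mul_left ?_ hw0
  nlinarith

variable {m : ℕ} {u : EuclideanSpace ℝ (Fin m) → ℝ} {x : EuclideanSpace ℝ (Fin m)}
  {s : Set (EuclideanSpace ℝ (Fin m))}

theorem laplacian_sq_le (u : EuclideanSpace ℝ (Fin m) → ℝ) (x : EuclideanSpace ℝ (Fin m)) :
    (∑ i, pd i (pd i u) x) ^ 2 ≤ m * ∑ i, ∑ j, pd i (pd j u) x ^ 2 := by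
  have h := sq_sum_le_card_mul_sum_sq (s := Finset.univ) (f := fun i => pd i (pd i u) x)
  rw [Finset.card_univ, Fintype.card_fin] at h
  refine h.trans (mul_le_mul_of_nonneg_left (Finset.sum_le_sum fun i _ => ?_) (Nat.cast_nonneg m))
  exact Finset.single_le_sum (f := fun j => pd i (pd j u) x ^ 2) (fun j _ => sq_nonneg _)
    (Finset.mem_univ i)

theorem sum_pd_mul_hessField_sq_le (hu : ContDiffAt ℝ 2 u x) (hlt : ‖gradient u x‖ < 1)
    {ζ : EuclideanSpace ℝ (Fin m) → ℝ} {L : ℝ} (hζ : ‖fderiv ℝ ζ x‖ ≤ L) :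
    (∑ k, pd k ζ x * hessField u k x) ^ 2 ≤
      L ^ 2 * (2 * ((∑ i, (∑ j, pd i (pd j u) x * pd j u x) ^ 2)
        + (∑ i, pd i (pd i u) x) ^ 2)) := by
  refine (Finset.sum_mul_sq_le_sq_mul_sq _ _ _).trans ?_
  rw [← norm_gradient_sq, norm_gradient]
  refine mul_le_mul (pow_le_pow_left₀ (norm_nonneg _) hζ 2) ?_
    (Finset.sum_nonneg fun _ _ => sq_nonneg _) (sq_nonneg _)
  set T := ∑ i, pd i (pd i u) x
  have h1 : ∀ k, hessField u k x ^ 2 ≤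
      2 * (∑ j, pd k (pd j u) x * pd j u x) ^ 2 + 2 * T ^ 2 * pd k u x ^ 2 := by
    intro k
    have : hessField u k x = (∑ j, pd k (pd j u) x * pd j u x) - pd k u x * T := by
      simp only [hessField, pd_pd_comm _ k hu, T]
    rw [this]
    nlinarith [sq_nonneg ((∑ j, pd k (pd j u) x * pd j u x) + pd k u x * T)]
  refine (Finset.sum_le_sum fun k _ => h1 k).trans ?_
  rw [Finset.sum_add_distrib, ← Finset.mul_sum, ← Finset.mul_sum, ← norm_gradient_sq]
  nlinarith [sq_nonneg T, one_sub_norm_gradient_sq_pos hlt,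
    mul_nonneg (sq_nonneg T) (one_sub_norm_gradient_sq_pos hlt).le]

end PointwiseEstimates

/-- Interior estimate for the Hessian terms with a cutoff function `ζ`. -/
theorem lintegral_cutoff_hessian_le {m : ℕ} (hm : 1 ≤ m) {s K : Set (EuclideanSpace ℝ (Fin m))}
    (hs : IsOpen s) (hK : IsCompact K) (hKs : K ⊆ s) {u ρ ζ : EuclideanSpace ℝ (Fin m) → ℝ}
    {Λ L : ℝ} (hL : 0 < L) (hu : ContDiffOn ℝ (⊤ : ℕ∞) u s)
    (hlt : ∀ y ∈ s, ‖gradient u y‖ < 1)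
    (hρ : ∀ y ∈ s, |lorentzMeanCurv u y - ρ y| ≤ Λ * tilt u y)
    (hζ : ContDiff ℝ (⊤ : ℕ∞) ζ) (hζK : ∀ y ∉ K, ζ y = 0) (hζ01 : ∀ y, ζ y ∈ Set.Icc (0 : ℝ) 1)
    (hζL : ∀ y, ‖fderiv ℝ ζ y‖ ≤ L) :
    ∫⁻ x in s, ENNReal.ofReal (ζ x ^ 2 / 2 * (tilt u x * (∑ i, ∑ j, pd i (pd j u) x ^ 2)
        + tilt u x ^ 3 * (∑ i, (∑ j, pd i (pd j u) x * pd j u x) ^ 2))) ≤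
      ∫⁻ x in s, ENNReal.ofReal
        (2 * m * ρ x ^ 2 + (2 * m * Λ ^ 2 + 8 * m * L ^ 2) * tilt u x) := by
  have hw := contDiffOn_tilt_s5 hs hu hlt
  have hm' : (1 : ℝ) ≤ m := by exact_mod_cast hm
  obtain ⟨hD, hD0⟩ := integral_divergence_eq_zero hs hK hKs
    (X := fun k y => ζ y * ζ y * (tilt u y * hessField u k y))
    (fun k => ((hζ.contDiffOn.mul hζ.contDiffOn).mul
      (hw.mul (contDiffOn_hessField hs hu k))).of_le (by simp))
    (fun k y hy => by simp [hζK y hy.2])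
  refine lintegral_le_of_le_add_of_integral_eq_zero hD hD0 ?_ ?_ ?_ <;>
    filter_upwards [ae_restrict_mem hs.measurableSet] with x hx
  · have := tilt_pos (hlt x hx)
    have h1 : 0 ≤ ∑ i, ∑ j, pd i (pd j u) x ^ 2 :=
      Finset.sum_nonneg fun _ _ => Finset.sum_nonneg fun _ _ => sq_nonneg _
    have h2 : 0 ≤ ∑ i, (∑ j, pd i (pd j u) x * pd j u x) ^ 2 :=
      Finset.sum_nonneg fun _ _ => sq_nonneg _
    positivity
  · have := tilt_pos (hlt x hx)
    positivity
  · rw [sum_pd_weighted_hessField hs hu hlt (hζ.differentiable (by simp) x) hx]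
    exact absorption_inequality (one_le_tilt (hlt x hx)) hm' hL
      (Finset.sum_nonneg fun _ _ => Finset.sum_nonneg fun _ _ => sq_nonneg _)
      (Finset.sum_nonneg fun _ _ => sq_nonneg _) (laplacian_sq_le u x) (hρ x hx)
      (sum_pd_mul_hessField_sq_le (contDiffAt_two_of_contDiffOn hs hu hx) (hlt x hx) (hζL x))
      (hζ01 x).1 (hζ01 x).2

section TiltIntegral

/-- Monotone `C¹` test functions vanishing near `0`, with `K |ψ| ≤ ψ'` and with `ψ'` bounded
independently of the size `δ` of the region around `0` which is neglected. -/
theorem exists_test_function {K δ : ℝ} (hK : 0 < K) (hδ : 0 < δ) :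
    ∃ ψ ψ' : ℝ → ℝ, (∀ s, HasDerivAt ψ (ψ' s) s) ∧ Continuous ψ' ∧
      (∀ s, K * |ψ s| ≤ ψ' s) ∧ (∀ s, ψ' s ≤ 2 * Real.exp (K * |s|)) ∧
      (∀ s, δ ≤ |s| → 1 ≤ ψ' s) ∧ (∀ s, |s| ≤ δ / 2 → ψ s = 0) := by
  set χ : ℝ → ℝ := fun t => max 0 (min 1 (2 * t / δ - 1)) with hχ
  have χ0 : ∀ t, 0 ≤ χ t := fun t => le_max_left _ _
  have χ1 : ∀ t, χ t ≤ 1 := fun t => max_le zero_le_one (min_le_left _ _)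
  have χmono : Monotone χ := by
    intro a b hab
    simp only [hχ]
    gcongr
  have χzero : ∀ t, t ≤ δ / 2 → χ t = 0 := by
    intro t ht
    refine max_eq_left ((min_le_right _ _).trans ?_)
    rw [sub_nonpos, div_le_one hδ]
    linarith
  have χone : ∀ t, δ ≤ t → χ t = 1 := by
    intro t ht
    have : 1 ≤ 2 * t / δ - 1 := by
      rw [le_sub_iff_add_le, le_div_iff₀ hδ]
      linarith
    simp only [hχ]
    rw [min_eq_left this]
    simp
  have χcont : Continuous χ := by fun_prop
  set f : ℝ → ℝ := fun t => Real.exp (K * t) * χ t with hf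
  have fcont : Continuous f := by fun_prop
  have f0 : ∀ t, 0 ≤ f t := fun t => mul_nonneg (Real.exp_pos _).le (χ0 t)
  have fle : ∀ t, f t ≤ Real.exp (K * |t|) := by
    intro t
    calc f t ≤ Real.exp (K * t) * 1 := mul_le_mul_of_nonneg_left (χ1 t) (Real.exp_pos _).le
      _ ≤ Real.exp (K * |t|) := by
        rw [mul_one]
        exact Real.exp_le_exp.2 (mul_le_mul_of_nonneg_left (le_abs_self t) hK.le)
  set g : ℝ → ℝ := fun s => ∫ t in (0 : ℝ)..s, f t with hg
  have gder : ∀ s, HasDerivAt g (f s) s := fun s =>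
    (fcont.integral_hasStrictDerivAt 0 s).hasDerivAt
  have gzero : ∀ s, s ≤ δ / 2 → g s = 0 := by
    intro s hs
    have : Set.EqOn f (fun _ => 0) (Set.uIcc 0 s) := by
      intro t ht
      have ht' : t ≤ max 0 s := ht.2
      have : t ≤ δ / 2 := ht'.trans (max_le (by positivity) hs)
      simp [hf, χzero t this]
    simp only [hg]
    rw [intervalIntegral.integral_congr this]
    simp
  have gbound : ∀ s, 0 ≤ g s ∧ K * g s ≤ f s := by
    intro s
    rcases le_total s 0 with hs | hs
    · rw [gzero s (hs.trans (by positivity))]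
      simpa using f0 s
    · refine ⟨intervalIntegral.integral_nonneg hs fun t _ => f0 t, ?_⟩
      have hexp : ∫ t in (0 : ℝ)..s, K * Real.exp (K * t) = Real.exp (K * s) - 1 := by
        have hd : ∀ t ∈ Set.uIcc 0 s, HasDerivAt (fun t => Real.exp (K * t))
            (K * Real.exp (K * t)) t := by
          intro t _
          have := ((hasDerivAt_id t).const_mul K).exp
          simpa [mul_comm] using this
        rw [intervalIntegral.integral_eq_sub_of_hasDerivAt hd
          (Continuous.intervalIntegrable (by fun_prop) _ _)]
        simp
      have hle : g s ≤ ∫ t in (0 : ℝ)..s, Real.exp (K * t) * χ s := by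
        refine intervalIntegral.integral_mono_on hs (fcont.intervalIntegrable _ _)
          (Continuous.intervalIntegrable (by fun_prop) _ _) fun t ht => ?_
        exact mul_le_mul_of_nonneg_left (χmono ht.2) (Real.exp_pos _).le
      rw [intervalIntegral.integral_mul_const] at hle
      rw [intervalIntegral.integral_const_mul] at hexp
      calc K * g s ≤ K * ((∫ t in (0 : ℝ)..s, Real.exp (K * t)) * χ s) :=
            mul_le_mul_of_nonneg_left hle hK.le
        _ = (Real.exp (K * s) - 1) * χ s := by rw [← mul_assoc, hexp]
        _ ≤ f s := mul_le_mul_of_nonneg_right (by linarith) (χ0 s)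
  refine ⟨fun s => g s - g (-s), fun s => f s + f (-s), fun s => ?_, by fun_prop, fun s => ?_,
    fun s => ?_, fun s hs => ?_, fun s hs => ?_⟩
  · have := (gder s).fun_sub ((gder (-s)).comp s (hasDerivAt_neg s))
    simpa [Function.comp_def] using this
  · have h1 := gbound s
    have h2 := gbound (-s)
    have : |g s - g (-s)| ≤ g s + g (-s) := abs_le.2 ⟨by linarith, by linarith⟩
    nlinarith
  · have h1 := fle s
    have h2 := fle (-s)
    rw [abs_neg] at h2
    linarith
  · have key : ∀ t, δ ≤ t → 1 ≤ f t := by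
      intro t ht
      simp only [hf]
      rw [χone t ht, mul_one]
      exact Real.one_le_exp (mul_nonneg hK.le (hδ.le.trans ht))
    rcases le_abs.1 hs with h | h
    · have := key s h
      have := f0 (-s)
      linarith
    · have := key (-s) h
      have := f0 s
      linarith
  · have := abs_le.1 hs
    beta_reduce
    rw [gzero s this.2, gzero (-s) (by linarith), sub_zero]

variable {m : ℕ}

/-- The derivative of a function vanishes almost everywhere on its zero set. -/
theorem ae_fderiv_eq_zero_of_eqOn_zero (hm : 0 < m) {s : Set (EuclideanSpace ℝ (Fin m))}
    (hs : MeasurableSet s) {v : EuclideanSpace ℝ (Fin m) → ℝ}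
    (hv : ∀ x ∈ s, DifferentiableAt ℝ v x) (hv0 : ∀ x ∈ s, v x = 0) :
    ∀ᵐ x ∂(volume.restrict s), fderiv ℝ v x = 0 := by
  set e : EuclideanSpace ℝ (Fin m) := EuclideanSpace.single ⟨0, hm⟩ 1 with he
  have hA : ApproximatesLinearOn (fun x => v x • e)
      (0 : EuclideanSpace ℝ (Fin m) →L[ℝ] EuclideanSpace ℝ (Fin m)) s 0 := by
    intro x hx y hy
    simp [hv0 x hx, hv0 y hy]
  have h := hA.norm_fderiv_sub_le volume hs (fun x => (fderiv ℝ v x).smulRight e) fun x hx =>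
    ((hv x hx).hasFDerivAt.smul_const e).hasFDerivWithinAt
  filter_upwards [h] with x hx
  have h0 : (fderiv ℝ v x).smulRight e = 0 := by
    simpa only [sub_zero, nonpos_iff_eq_zero, nnnorm_eq_zero] using hx
  ext y
  have h1 := congrArg (fun T => T y ⟨0, hm⟩) h0
  simpa [he] using h1

theorem abs_le_two_mul_diam {Ω : Set (EuclideanSpace ℝ (Fin m))} (hm : 0 < m) (hΩo : IsOpen Ω)
    (hΩb : Bornology.IsBounded Ω) {v : EuclideanSpace ℝ (Fin m) → ℝ}
    (hv : ∀ x ∈ closure Ω, DifferentiableAt ℝ v x) (hv2 : ∀ x ∈ closure Ω, ‖fderiv ℝ v x‖ ≤ 2)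
    (hv0 : ∀ x ∈ frontier Ω, v x = 0) {x : EuclideanSpace ℝ (Fin m)} (hx : x ∈ Ω) :
    |v x| ≤ 2 * Metric.diam (closure Ω) := by
  have : Nonempty (Fin m) := ⟨⟨0, hm⟩⟩
  have hne : (Ωᶜ).Nonempty := by
    rw [Set.nonempty_compl]
    rintro rfl
    exact NormedSpace.unbounded_univ ℝ (EuclideanSpace ℝ (Fin m)) hΩb
  obtain ⟨y, hy, hxy⟩ := hΩo.isClosed_compl.exists_infDist_eq_dist hne x
  have hpos : dist x y ≠ 0 := by
    rw [dist_ne_zero]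
    rintro rfl
    exact hy hx
  have hball : Metric.ball x (dist x y) ⊆ Ω := by
    rw [← hxy]
    exact Metric.ball_infDist_compl_subset
  have hcb : Metric.closedBall x (dist x y) ⊆ closure Ω := by
    rw [← closure_ball x hpos]
    exact closure_mono hball
  have hyc : y ∈ Metric.closedBall x (dist x y) := by simp [dist_comm]
  have hyf : y ∈ frontier Ω := by
    rw [hΩo.frontier_eq]
    exact ⟨hcb hyc, hy⟩
  have h := (convex_closedBall x (dist x y)).norm_image_sub_le_of_norm_fderiv_le
    (fun z hz => hv z (hcb hz)) (fun z hz => hv2 z (hcb hz)) hyc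
    (Metric.mem_closedBall_self dist_nonneg)
  rw [hv0 y hyf, sub_zero, Real.norm_eq_abs, ← dist_eq_norm] at h
  exact h.trans (mul_le_mul_of_nonneg_left
    (Metric.dist_le_diam_of_mem hΩb.closure (subset_closure hx) (hcb hyc)) zero_le_two)

theorem four_mul_tilt_sub_one_le {u φ : EuclideanSpace ℝ (Fin m) → ℝ}
    {x : EuclideanSpace ℝ (Fin m)} {θ : ℝ} (hu : DifferentiableAt ℝ u x)
    (hφ : DifferentiableAt ℝ φ x) (hlt : ‖gradient u x‖ < 1) (hφ1 : ‖gradient φ x‖ ≤ 1 - 4 * θ) :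
    4 * θ * tilt u x - 1 ≤ tilt u x * ∑ i, pd i (fun y => u y - φ y) x * pd i u x := by
  have h1 : ∑ i, pd i (fun y => u y - φ y) x * pd i u x =
      ‖gradient u x‖ ^ 2 - ∑ i, pd i φ x * pd i u x := by
    rw [norm_gradient_sq, ← Finset.sum_sub_distrib]
    refine Finset.sum_congr rfl fun i _ => ?_
    rw [pd_sub i hu hφ]
    ring
  have h2 : ∑ i, pd i φ x * pd i u x ≤ 1 - 4 * θ := by
    have h3 := Finset.sum_mul_sq_le_sq_mul_sq Finset.univ (fun i => pd i φ x) fun i => pd i u x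
    rw [← norm_gradient_sq, ← norm_gradient_sq, ← mul_pow] at h3
    have h4 := abs_le_of_sq_le_sq h3 (by positivity)
    have h5 : ‖gradient φ x‖ * ‖gradient u x‖ ≤ ‖gradient φ x‖ * 1 :=
      mul_le_mul_of_nonneg_left hlt.le (norm_nonneg _)
    linarith [(abs_le.1 h4).2]
  have h6 := tilt_sq_mul hlt
  have h7 := one_le_tilt hlt
  have h8 : tilt u x * (1 - ‖gradient u x‖ ^ 2) ≤ 1 := by
    nlinarith [one_sub_norm_gradient_sq_pos hlt]
  rw [h1]
  nlinarith

end TiltIntegral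

section TiltBound

variable {m : ℕ} {Ω : Set (EuclideanSpace ℝ (Fin m))} {u ρ φ : EuclideanSpace ℝ (Fin m) → ℝ}
  {θ Λ B : ℝ}

/-- The tilt is controlled in `L¹` on the region where `u - φ` is bounded away from zero. -/
theorem lintegral_tilt_off_contact_le (hΩo : IsOpen Ω) (hΩb : Bornology.IsBounded Ω)
    (hθ : 0 < θ) (hφ : ContDiff ℝ (⊤ : ℕ∞) φ) (hφg : ∀ x ∈ Ω, ‖gradient φ x‖ ≤ 1 - 4 * θ)
    (hΛ : 0 ≤ Λ) (hu : ContDiffOn ℝ (⊤ : ℕ∞) u Ω) (huc : ContinuousOn u (closure Ω))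
    (hlt : ∀ y ∈ Ω, ‖gradient u y‖ < 1) (hbd : ∀ x ∈ frontier Ω, u x = φ x)
    (hρ : ∀ y ∈ Ω, |lorentzMeanCurv u y - ρ y| ≤ Λ * tilt u y)
    (hB : ∀ x ∈ Ω, |u x - φ x| ≤ B) {δ : ℝ} (hδ : 0 < δ) :
    ∫⁻ x in (closure Ω ∩ {x | δ ≤ |u x - φ x|}) ∩ Ω, ENNReal.ofReal (2 * θ * tilt u x) ≤
      ∫⁻ x in Ω, ENNReal.ofReal (2 * Real.exp ((Λ / (2 * θ) + 1) * B) * (1 + |ρ x|)) := by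
  set K := Λ / (2 * θ) + 1 with hK
  have hΛθ : 0 ≤ Λ / (2 * θ) := by positivity
  have hK1 : 1 ≤ K := by linarith
  have hKΛ : Λ ≤ 2 * θ * K := by
    rw [hK, mul_add, mul_div_cancel₀ _ (by positivity)]
    linarith
  obtain ⟨ψ, ψ', hψ, hψ'c, hψK, hψub, hψlb, hψ0⟩ := exists_test_function (K := K) (by linarith) hδ
  set v : EuclideanSpace ℝ (Fin m) → ℝ := fun x => u x - φ x with hv
  have hvc : ContinuousOn v (closure Ω) := huc.sub hφ.continuous.continuousOn
  have hvs : ContDiffOn ℝ (⊤ : ℕ∞) v Ω := hu.sub hφ.contDiffOn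
  have hclosed : ∀ η : ℝ, IsClosed (closure Ω ∩ {x | η ≤ |v x|}) := fun η =>
    hvc.abs.preimage_isClosed_of_isClosed isClosed_closure isClosed_Ici
  have hw := contDiffOn_tilt_s5 hΩo hu hlt
  have hψ1 : ContDiff ℝ 1 ψ := by
    rw [contDiff_one_iff_deriv]
    refine ⟨fun s => (hψ s).differentiableAt, ?_⟩
    rwa [show deriv ψ = ψ' from funext fun s => (hψ s).deriv]
  have hX : ∀ i, ContDiffOn ℝ 1 (fun y => ψ (v y) * (tilt u y * pd i u y)) Ω := fun i =>
    (hψ1.comp_contDiffOn (hvs.of_le (by simp))).mul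
      ((hw.mul (contDiffOn_pd_infty i hΩo hu)).of_le (by simp))
  obtain ⟨hD, hD0⟩ := integral_divergence_eq_zero hΩo
    (K := closure Ω ∩ {x | δ / 2 ≤ |v x|})
    (hΩb.isCompact_closure.of_isClosed_subset (hclosed _) Set.inter_subset_left)
    (by
      rintro x ⟨hx, hxδ⟩
      by_contra hxΩ
      have h0 : v x = 0 := sub_eq_zero.2 (hbd x (by rw [hΩo.frontier_eq]; exact ⟨hx, hxΩ⟩))
      simp only [Set.mem_ofPred_eq, h0, abs_zero] at hxδ
      linarith)
    hX
    (by
      rintro i x ⟨hx, hxK⟩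
      have : |v x| < δ / 2 := by
        by_contra! h
        exact hxK ⟨subset_closure hx, h⟩
      simp only [hψ0 _ this.le, zero_mul])
  have hmeas : MeasurableSet (closure Ω ∩ {x | δ ≤ |v x|}) := (hclosed δ).measurableSet
  rw [← Measure.restrict_restrict hmeas, ← lintegral_indicator hmeas]
  have hind : ∀ x, (closure Ω ∩ {x | δ ≤ |v x|}).indicator
      (fun x => ENNReal.ofReal (2 * θ * tilt u x)) x = ENNReal.ofReal
        ((closure Ω ∩ {x | δ ≤ |v x|}).indicator (fun x => 2 * θ * tilt u x) x) := by
    intro x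
    by_cases hx : x ∈ closure Ω ∩ {x | δ ≤ |v x|}
    · simp only [Set.indicator_of_mem hx]
    · simp only [Set.indicator_of_notMem hx, ENNReal.ofReal_zero]
  simp only [hind]
  refine lintegral_le_of_le_add_of_integral_eq_zero hD hD0 ?_ ?_ ?_ <;>
    filter_upwards [ae_restrict_mem hΩo.measurableSet] with x hx
  · exact Set.indicator_nonneg (fun y _ => mul_nonneg (by positivity) (tilt_nonneg u y)) x
  · positivity
  · have hux := differentiableAt_of_contDiffOn hΩo hu hx
    have hφx : DifferentiableAt ℝ φ x := hφ.differentiable (by simp) x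
    have hwx := differentiableAt_of_contDiffOn hΩo hw hx
    have hdx := fun i => differentiableAt_of_contDiffOn hΩo (contDiffOn_pd_infty i hΩo hu) hx
    have hdiv : ∑ i, pd i (fun y => ψ (v y) * (tilt u y * pd i u y)) x =
        ψ' (v x) * (tilt u x * ∑ i, pd i v x * pd i u x) + ψ (v x) * lorentzMeanCurv u x := by
      simp only [lorentzMeanCurv, gradient_apply_eq_pd]
      rw [Finset.mul_sum, Finset.mul_sum, Finset.mul_sum, ← Finset.sum_add_distrib]
      refine Finset.sum_congr rfl fun i _ => ?_
      have hvx : DifferentiableAt ℝ v x := hux.sub hφx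
      rw [pd_mul i (f := fun y => ψ (v y)) ((hψ _).differentiableAt.comp x hvx) (hwx.fun_mul (hdx i)),
        pd_comp i (hψ (v x)) hvx]
      ring
    have h1 := four_mul_tilt_sub_one_le hux hφx (hlt x hx) (hφg x hx)
    have h2 := one_le_tilt (hlt x hx)
    have hBx : ψ' (v x) ≤ 2 * Real.exp (K * B) := (hψub _).trans (by
      gcongr
      exact hB x hx)
    have h3 := hψK (v x)
    have hψ'0 : 0 ≤ ψ' (v x) := le_trans (by positivity) h3
    have h4 : |ψ (v x)| ≤ ψ' (v x) := by nlinarith [abs_nonneg (ψ (v x))]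
    have h5 : -(ψ (v x) * lorentzMeanCurv u x) ≤ ψ' (v x) * |ρ x| + 2 * θ * tilt u x * ψ' (v x) := by
      have h6 : |lorentzMeanCurv u x| ≤ |ρ x| + Λ * tilt u x := by
        have := abs_add_le (ρ x) (lorentzMeanCurv u x - ρ x)
        rw [add_sub_cancel] at this
        linarith [hρ x hx]
      have h7 : Λ * |ψ (v x)| ≤ 2 * θ * ψ' (v x) := by
        calc Λ * |ψ (v x)| ≤ 2 * θ * K * |ψ (v x)| :=
              mul_le_mul_of_nonneg_right hKΛ (abs_nonneg _)
          _ ≤ 2 * θ * ψ' (v x) := by nlinarith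
      calc -(ψ (v x) * lorentzMeanCurv u x) ≤ |ψ (v x)| * |lorentzMeanCurv u x| := by
            rw [← abs_mul]
            exact neg_le_abs _
        _ ≤ |ψ (v x)| * (|ρ x| + Λ * tilt u x) := mul_le_mul_of_nonneg_left h6 (abs_nonneg _)
        _ = |ψ (v x)| * |ρ x| + tilt u x * (Λ * |ψ (v x)|) := by ring
        _ ≤ ψ' (v x) * |ρ x| + tilt u x * (2 * θ * ψ' (v x)) := by gcongr
        _ = _ := by ring
    have h8 := mul_le_mul_of_nonneg_left h1 hψ'0
    have h9 : ψ' (v x) * (1 + |ρ x|) ≤ 2 * Real.exp (K * B) * (1 + |ρ x|) := by gcongr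
    have h10 : ψ' (v x) * (2 * θ * tilt u x) ≤
        (∑ i, pd i (fun y => ψ (v y) * (tilt u y * pd i u y)) x)
          + 2 * Real.exp (K * B) * (1 + |ρ x|) := by
      rw [hdiv]
      linarith
    refine le_trans ?_ h10
    by_cases hxA : x ∈ closure Ω ∩ {x | δ ≤ |v x|}
    · rw [Set.indicator_of_mem hxA]
      have := hψlb _ hxA.2
      exact le_mul_of_one_le_left (by positivity) this
    · rw [Set.indicator_of_notMem hxA]
      positivity

theorem lintegral_tilt_le (hm : 0 < m) (hΩo : IsOpen Ω) (hΩb : Bornology.IsBounded Ω)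
    (hθ : 0 < θ) (hφ : ContDiff ℝ (⊤ : ℕ∞) φ) (hφg : ∀ x ∈ Ω, ‖gradient φ x‖ ≤ 1 - 4 * θ)
    (hΛ : 0 ≤ Λ) (hu : ContDiffOn ℝ (⊤ : ℕ∞) u Ω) (huc : ContinuousOn u (closure Ω))
    (hlt : ∀ y ∈ Ω, ‖gradient u y‖ < 1) (hbd : ∀ x ∈ frontier Ω, u x = φ x)
    (hρ : ∀ y ∈ Ω, |lorentzMeanCurv u y - ρ y| ≤ Λ * tilt u y)
    (hB : ∀ x ∈ Ω, |u x - φ x| ≤ B) (hB0 : 0 ≤ B) :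
    ∫⁻ x in Ω, ENNReal.ofReal (2 * θ * tilt u x) ≤
      2 * ∫⁻ x in Ω, ENNReal.ofReal (2 * Real.exp ((Λ / (2 * θ) + 1) * B) * (1 + |ρ x|)) := by
  set A : ℕ → Set (EuclideanSpace ℝ (Fin m)) := fun n =>
    closure Ω ∩ {x | 1 / ((n : ℝ) + 1) ≤ |u x - φ x|} with hA
  have hAmeas : ∀ n, MeasurableSet (A n) := fun n =>
    ((huc.sub hφ.continuous.continuousOn).abs.preimage_isClosed_of_isClosed isClosed_closure
      isClosed_Ici).measurableSet
  have hAmono : Monotone A := by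
    intro n k hnk x hx
    have h1 : 1 / ((n : ℝ) + 1) ≤ |u x - φ x| := hx.2
    have h2 : 1 / ((k : ℝ) + 1) ≤ 1 / ((n : ℝ) + 1) := Nat.one_div_le_one_div hnk
    exact ⟨hx.1, le_trans h2 h1⟩
  rw [← lintegral_inter_add_sdiff _ Ω (MeasurableSet.iUnion hAmeas), two_mul (_ : ENNReal)]
  refine add_le_add ?_ ?_
  · rw [Set.inter_iUnion, setLIntegral_iUnion_of_directed]
    · refine iSup_le fun n => ?_
      rw [Set.inter_comm]
      exact lintegral_tilt_off_contact_le hΩo hΩb hθ hφ hφg hΛ hu huc hlt hbd hρ hB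
        Nat.one_div_pos_of_nat
    · exact Monotone.directed_le fun n k hnk => Set.inter_subset_inter_right _ (hAmono hnk)
  · set Z := Ω \ ⋃ n, A n with hZ
    have hZm : MeasurableSet Z := hΩo.measurableSet.diff (MeasurableSet.iUnion hAmeas)
    have hd : ∀ x ∈ Z, DifferentiableAt ℝ (fun y => u y - φ y) x := fun x hx =>
      (differentiableAt_of_contDiffOn hΩo hu hx.1).sub (hφ.differentiable (by simp) x)
    have hZ0 : ∀ x ∈ Z, u x - φ x = 0 := by
      intro x hx
      by_contra h
      obtain ⟨n, hn⟩ := exists_nat_one_div_lt (abs_pos.2 h)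
      exact hx.2 (Set.mem_iUnion.2 ⟨n, subset_closure hx.1, hn.le⟩)
    refine (lintegral_mono_ae ?_).trans (lintegral_mono_set Set.sdiff_subset)
    filter_upwards [ae_fderiv_eq_zero_of_eqOn_zero hm hZm hd hZ0, ae_restrict_mem hZm] with x hx hxZ
    refine ENNReal.ofReal_le_ofReal ?_
    have h1 := four_mul_tilt_sub_one_le (differentiableAt_of_contDiffOn hΩo hu hxZ.1)
      (hφ.differentiable (by simp) x) (hlt x hxZ.1) (hφg x hxZ.1)
    simp only [pd, hx, _root_.zero_apply, zero_mul, Finset.sum_const_zero,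
      mul_zero] at h1
    have h2 : 1 ≤ Real.exp ((Λ / (2 * θ) + 1) * B) := Real.one_le_exp (by positivity)
    nlinarith [abs_nonneg (ρ x)]

/-- `L¹` bound for the tilt of admissible solutions. -/
theorem exists_lintegral_tilt_le (hm : 0 < m) (hΩo : IsOpen Ω) (hΩb : Bornology.IsBounded Ω)
    (hθ : 0 < θ) (hφ : ContDiff ℝ (⊤ : ℕ∞) φ)
    (hφg : ∀ x ∈ closure Ω, ‖gradient φ x‖ ≤ 1 - 4 * θ) (hΛ : 0 ≤ Λ) :
    ∃ C : ℝ, 0 < C ∧ ∀ I : ℝ, 0 ≤ I → ∀ u ρ, IsAdmissible Ω φ Λ u ρ →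
      (∫⁻ x in Ω, ENNReal.ofReal |ρ x|) ≤ ENNReal.ofReal I →
      ∫⁻ x in Ω, ENNReal.ofReal (tilt u x) ≤ ENNReal.ofReal (C * (I + 1)) := by
  set M := 2 * Real.exp ((Λ / (2 * θ) + 1) * (2 * Metric.diam (closure Ω))) with hM
  have hM0 : 0 < M := by positivity
  set a := (volume Ω).toReal with ha
  have ha0 : 0 ≤ a := ENNReal.toReal_nonneg
  refine ⟨M / θ * (a + 1), by positivity, ?_⟩
  rintro I hI u ρ ⟨⟨V, hVo, hΩV, huV⟩, hlt, hbd, -, hρ⟩ hρI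
  have huΩ : ContDiffOn ℝ (⊤ : ℕ∞) u Ω := huV.mono (subset_closure.trans hΩV)
  have hdu : ∀ x ∈ closure Ω, DifferentiableAt ℝ u x := fun x hx =>
    differentiableAt_of_contDiffOn hVo huV (hΩV hx)
  have hdφ : ∀ x, DifferentiableAt ℝ φ x := fun x => hφ.differentiable (by simp) x
  have hB : ∀ x ∈ Ω, |u x - φ x| ≤ 2 * Metric.diam (closure Ω) := fun x hx => by
    refine abs_le_two_mul_diam (v := fun y => u y - φ y) hm hΩo hΩb
      (fun y hy => (hdu y hy).sub (hdφ y)) (fun y hy => ?_)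
      (fun y hy => sub_eq_zero.2 (hbd y hy)) hx
    rw [fderiv_fun_sub (hdu y hy) (hdφ y)]
    refine (norm_sub_le _ _).trans ?_
    rw [← norm_gradient, ← norm_gradient]
    linarith [hlt y hy, hφg y hy]
  have h := lintegral_tilt_le hm hΩo hΩb hθ hφ (fun x hx => hφg x (subset_closure hx)) hΛ huΩ
    (huV.continuousOn.mono hΩV) (fun y hy => hlt y (subset_closure hy)) hbd hρ hB
    (by positivity)
  rw [← hM] at h
  have hvol : volume Ω = ENNReal.ofReal a :=
    (ENNReal.ofReal_toReal hΩb.measure_lt_top.ne).symm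
  have h2 : ∫⁻ x in Ω, ENNReal.ofReal (M * (1 + |ρ x|)) ≤ ENNReal.ofReal (M * (a + I)) := by
    have : ∀ x, ENNReal.ofReal (M * (1 + |ρ x|)) =
        ENNReal.ofReal M * (1 + ENNReal.ofReal |ρ x|) := fun x => by
      rw [ENNReal.ofReal_mul hM0.le, ENNReal.ofReal_add zero_le_one (abs_nonneg _),
        ENNReal.ofReal_one]
    simp only [this]
    rw [lintegral_const_mul' _ _ ENNReal.ofReal_ne_top, lintegral_add_left measurable_const,
      ENNReal.ofReal_mul hM0.le, ENNReal.ofReal_add ha0 hI]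
    gcongr
    simp [hvol]
  have h3 : ∀ x, ENNReal.ofReal (2 * θ * tilt u x) =
      ENNReal.ofReal (2 * θ) * ENNReal.ofReal (tilt u x) := fun x =>
    ENNReal.ofReal_mul (by positivity)
  simp only [h3] at h
  rw [lintegral_const_mul' _ _ ENNReal.ofReal_ne_top] at h
  have h4 : ENNReal.ofReal (2 * θ) * ∫⁻ x in Ω, ENNReal.ofReal (tilt u x) ≤
      ENNReal.ofReal (2 * θ) * ENNReal.ofReal (M / θ * (a + 1) * (I + 1)) := by
    refine h.trans ((mul_le_mul_right h2 2).trans ?_)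
    rw [← ENNReal.ofReal_mul (by positivity), ← ENNReal.ofReal_ofNat,
      ← ENNReal.ofReal_mul (by positivity)]
    refine ENNReal.ofReal_le_ofReal ?_
    have e : 2 * θ * (M / θ * (a + 1) * (I + 1)) = 2 * (M * ((a + 1) * (I + 1))) := by
      field_simp
    rw [e]
    have : a + I ≤ (a + 1) * (I + 1) := by nlinarith
    nlinarith
  exact (ENNReal.mul_le_mul_iff_right (by simpa using hθ) ENNReal.ofReal_ne_top).1 h4

end TiltBound

theorem exists_cutoff {m : ℕ} {Ω' : Set (EuclideanSpace ℝ (Fin m))} (hΩ'o : IsOpen Ω')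
    (hΩ'c : IsCompact (closure Ω')) {ε : ℝ} (hε : 0 < ε) :
    ∃ (K : Set (EuclideanSpace ℝ (Fin m))) (ζ : EuclideanSpace ℝ (Fin m) → ℝ) (L : ℝ),
      IsCompact K ∧ K ⊆ Ω' ∧ 0 < L ∧ ContDiff ℝ (⊤ : ℕ∞) ζ ∧ (∀ y ∉ K, ζ y = 0) ∧
      (∀ y, ζ y ∈ Set.Icc (0 : ℝ) 1) ∧ (∀ y, ‖fderiv ℝ ζ y‖ ≤ L) ∧
      ∀ x ∈ Ω', ε < Metric.infDist x (frontier Ω') → ζ x = 1 := by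
  set K₀ := closure Ω' ∩ {x | ε ≤ Metric.infDist x (frontier Ω')} with hK₀
  have hK₀c : IsCompact K₀ :=
    hΩ'c.inter_right (isClosed_le continuous_const (Metric.continuous_infDist_pt _))
  have hK₀s : K₀ ⊆ Ω' := by
    rintro x ⟨hx, hxε⟩
    by_contra h
    have hf : x ∈ frontier Ω' := by
      rw [hΩ'o.frontier_eq]
      exact ⟨hx, h⟩
    have h0 : ε ≤ Metric.infDist x (frontier Ω') := hxε
    rw [Metric.infDist_zero_of_mem hf] at h0
    linarith
  obtain ⟨K, hK, hK₀K, hKs⟩ := exists_compact_between hK₀c hΩ'o hK₀s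
  obtain ⟨f, hf1, hf0, hf01⟩ := exists_contMDiffMap_one_nhds_of_subset_interior
    (n := (⊤ : ℕ∞)) (modelWithCornersSelf ℝ (EuclideanSpace ℝ (Fin m))) hK₀c.isClosed hK₀K
  have hfd : ContDiff ℝ (⊤ : ℕ∞) f := f.contMDiff.contDiff
  have hsupp : HasCompactSupport f := HasCompactSupport.intro hK hf0
  obtain ⟨L, hL⟩ := (hfd.continuous_fderiv (by simp)).bounded_above_of_compact_support
    (hsupp.fderiv (𝕜 := ℝ))
  refine ⟨K, f, max L 1, hK, hKs, by positivity, hfd, hf0, hf01,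
    fun y => (hL y).trans (le_max_left _ _), fun x hx hxε => ?_⟩
  exact hf1.self_of_nhdsSet x ⟨subset_closure hx, hxε.le⟩

theorem lintegral_ofReal_linear_combination_le {α : Type*} [MeasurableSpace α] {μ : Measure α}
    {a b : α → ℝ} {A B c d : ℝ} (hb : AEMeasurable b μ) (hc : 0 ≤ c) (hd : 0 ≤ d) (hA : 0 ≤ A)
    (hB : 0 ≤ B) (haA : ∫⁻ x, ENNReal.ofReal (a x) ∂μ ≤ ENNReal.ofReal A)
    (hbB : ∫⁻ x, ENNReal.ofReal (b x) ∂μ ≤ ENNReal.ofReal B) :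
    ∫⁻ x, ENNReal.ofReal (c * a x + d * b x) ∂μ ≤ ENNReal.ofReal (c * A + d * B) := by
  calc ∫⁻ x, ENNReal.ofReal (c * a x + d * b x) ∂μ
      ≤ ∫⁻ x, ENNReal.ofReal c * ENNReal.ofReal (a x)
          + ENNReal.ofReal d * ENNReal.ofReal (b x) ∂μ := by
        refine lintegral_mono fun x => ?_
        rw [← ENNReal.ofReal_mul hc, ← ENNReal.ofReal_mul hd]
        exact ENNReal.ofReal_add_le
    _ = ENNReal.ofReal c * ∫⁻ x, ENNReal.ofReal (a x) ∂μ
          + ENNReal.ofReal d * ∫⁻ x, ENNReal.ofReal (b x) ∂μ := by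
        rw [lintegral_add_right' _ (hb.ennreal_ofReal.const_mul _),
          lintegral_const_mul' _ _ ENNReal.ofReal_ne_top,
          lintegral_const_mul' _ _ ENNReal.ofReal_ne_top]
    _ ≤ ENNReal.ofReal c * ENNReal.ofReal A + ENNReal.ofReal d * ENNReal.ofReal B := by gcongr
    _ = ENNReal.ofReal (c * A + d * B) := by
        rw [← ENNReal.ofReal_mul hc, ← ENNReal.ofReal_mul hd,
          ENNReal.ofReal_add (by positivity) (by positivity)]

/-- Weighted Hessian and `|D ln w_u|` estimates on `Ω′_ε = {x ∈ Ω′ : dist(x, ∂Ω′) > ε}`: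
for every admissible solution with `∫_Ω |ρ| ≤ I₁` and `‖ρ‖_{L²(Ω′)} ≤ I₂`, both
`∫_{Ω′_ε} (w|D²u|² + w³|D²u·Du|² + w⁵ (D²u(Du,Du))²)` and `∫_{Ω′_ε} |D ln w|`
are at most `C (I₂² + I₁ + 1)` with `C = C(m, Ω, φ, θ, Λ, Ω′, ε)`. -/
theorem hessian_and_log_tilt_estimate (m : ℕ) (hm : 2 ≤ m)
    (Ω : Set (EuclideanSpace ℝ (Fin m))) (hΩo : IsOpen Ω) (hΩb : Bornology.IsBounded Ω)
    (θ : ℝ) (hθ : θ ∈ Set.Ioo (0 : ℝ) (1/4))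
    (φ : EuclideanSpace ℝ (Fin m) → ℝ) (hφ : ContDiff ℝ (⊤ : ℕ∞) φ)
    (hφg : ∀ x ∈ closure Ω, ‖gradient φ x‖ ≤ 1 - 4 * θ)
    (Λ : ℝ) (hΛ : 0 ≤ Λ)
    (Ω' : Set (EuclideanSpace ℝ (Fin m))) (hΩ'o : IsOpen Ω')
    (hΩ'c : IsCompact (closure Ω')) (hΩ'sub : closure Ω' ⊆ Ω)
    (ε : ℝ) (hε : 0 < ε) :
    ∃ C : ℝ, 0 < C ∧
      ∀ I₁ I₂ : ℝ, 0 ≤ I₁ → 0 ≤ I₂ →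
      ∀ u ρ : EuclideanSpace ℝ (Fin m) → ℝ, IsAdmissible Ω φ Λ u ρ →
        (∫⁻ x in Ω, ENNReal.ofReal |ρ x|) ≤ ENNReal.ofReal I₁ →
        (∫⁻ x in Ω', ENNReal.ofReal (ρ x ^ 2)) ≤ ENNReal.ofReal (I₂ ^ 2) →
        (∫⁻ x in {x ∈ Ω' | ε < Metric.infDist x (frontier Ω')},
            ENNReal.ofReal
              (tilt u x * (∑ i, ∑ j, hess u x i j ^ 2)
                + tilt u x ^ 3 * (∑ i, (∑ j, hess u x i j * (gradient u x) j) ^ 2)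
                + tilt u x ^ 5 *
                    (∑ i, ∑ j, hess u x i j * (gradient u x) i * (gradient u x) j) ^ 2)
          ≤ ENNReal.ofReal (C * (I₂ ^ 2 + I₁ + 1))) ∧
        (∫⁻ x in {x ∈ Ω' | ε < Metric.infDist x (frontier Ω')},
            ENNReal.ofReal ‖gradient (fun y => Real.log (tilt u y)) x‖
          ≤ ENNReal.ofReal (C * (I₂ ^ 2 + I₁ + 1))) := by
  have hm0 : 0 < m := by omega
  obtain ⟨P, hP, hPu⟩ := exists_lintegral_tilt_le hm0 hΩo hΩb hθ.1 hφ hφg hΛ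
  obtain ⟨K, ζ, L, hK, hKs, hL, hζ, hζK, hζ01, hζL, hζ1⟩ := exists_cutoff hΩ'o hΩ'c hε
  set c : ℝ := 2 * m * Λ ^ 2 + 8 * m * L ^ 2 with hc
  have hc0 : 0 ≤ c := by positivity
  refine ⟨2 * (1 + 3 * m) * (2 * m + c * P) + 3 + 3 * Λ ^ 2 * P + P, by positivity, ?_⟩
  rintro I₁ I₂ hI₁ hI₂ u ρ hadm hρ1 hρ2
  have htilt := hPu I₁ hI₁ u ρ hadm hρ1
  obtain ⟨⟨V, hVo, hΩV, huV⟩, hlt, -, hρc, hρ⟩ := hadm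
  have hsub : Ω' ⊆ Ω := subset_closure.trans hΩ'sub
  have hu : ContDiffOn ℝ (⊤ : ℕ∞) u Ω' := huV.mono (hsub.trans (subset_closure.trans hΩV))
  have hlt' : ∀ y ∈ Ω', ‖gradient u y‖ < 1 := fun y hy => hlt y (subset_closure (hsub hy))
  have hρ' : ∀ y ∈ Ω', |lorentzMeanCurv u y - ρ y| ≤ Λ * tilt u y := fun y hy => hρ y (hsub hy)
  have hw : ∫⁻ x in Ω', ENNReal.ofReal (tilt u x) ≤ ENNReal.ofReal (P * (I₁ + 1)) :=
    (lintegral_mono_set hsub).trans htilt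
  have hwm : AEMeasurable (tilt u) (volume.restrict Ω') :=
    (contDiffOn_tilt_s5 hΩ'o hu hlt').continuousOn.aemeasurable hΩ'o.measurableSet
  have hρm : AEMeasurable (fun x => ρ x ^ 2) (volume.restrict Ω') :=
    ((hρc.mono hsub).pow 2).aemeasurable hΩ'o.measurableSet
  set S : EuclideanSpace ℝ (Fin m) → ℝ := fun x => ∑ i, ∑ j, pd i (pd j u) x ^ 2 with hS
  set G : EuclideanSpace ℝ (Fin m) → ℝ := fun x => ∑ i, (∑ j, pd i (pd j u) x * pd j u x) ^ 2
    with hG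
  set Q : EuclideanSpace ℝ (Fin m) → ℝ := fun x => ∑ i, ∑ j, pd i (pd j u) x * pd i u x * pd j u x
    with hQ
  have hS0 : ∀ x, 0 ≤ S x := fun x =>
    Finset.sum_nonneg fun _ _ => Finset.sum_nonneg fun _ _ => sq_nonneg _
  have hG0 : ∀ x, 0 ≤ G x := fun x => Finset.sum_nonneg fun _ _ => sq_nonneg _
  set A : EuclideanSpace ℝ (Fin m) → ℝ := fun x =>
    ζ x ^ 2 / 2 * (tilt u x * S x + tilt u x ^ 3 * G x) with hA
  have hPI : 0 ≤ P * (I₁ + 1) := by positivity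
  have hAint : ∫⁻ x in Ω', ENNReal.ofReal (A x) ≤
      ENNReal.ofReal (2 * m * I₂ ^ 2 + c * (P * (I₁ + 1))) :=
    (lintegral_cutoff_hessian_le hm0 hΩ'o hK hKs hL hu hlt' hρ' hζ hζK hζ01 hζL).trans
      (lintegral_ofReal_linear_combination_le hwm (by positivity) hc0 (by positivity) hPI hρ2 hw)
  have hmeas : MeasurableSet {x ∈ Ω' | ε < Metric.infDist x (frontier Ω')} :=
    (hΩ'o.inter (isOpen_lt continuous_const (Metric.continuous_infDist_pt _))).measurableSet
  have hsub' : {x ∈ Ω' | ε < Metric.infDist x (frontier Ω')} ⊆ Ω' := fun x hx => hx.1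
  have hA1 : ∀ x ∈ {x ∈ Ω' | ε < Metric.infDist x (frontier Ω')},
      tilt u x * S x + tilt u x ^ 3 * G x = 2 * A x := fun x hx => by
    simp only [hA, hζ1 x hx.1 hx.2]
    ring
  have hm1 : (1 : ℝ) ≤ m := by exact_mod_cast hm0
  have hcP : 0 ≤ c * P := by positivity
  have hIJ : 2 * m * I₂ ^ 2 + c * (P * (I₁ + 1)) ≤ (2 * m + c * P) * (I₂ ^ 2 + I₁ + 1) := by
    nlinarith [sq_nonneg I₂, mul_nonneg hcP (sq_nonneg I₂)]
  have hIJ0 : 0 ≤ 2 * m * I₂ ^ 2 + c * (P * (I₁ + 1)) := by positivity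
  have hPJ : P * (I₁ + 1) ≤ P * (I₂ ^ 2 + I₁ + 1) :=
    mul_le_mul_of_nonneg_left (by nlinarith [sq_nonneg I₂]) hP.le
  constructor
  · have hpt : ∀ x ∈ {x ∈ Ω' | ε < Metric.infDist x (frontier Ω')},
        tilt u x * (∑ i, ∑ j, hess u x i j ^ 2)
          + tilt u x ^ 3 * (∑ i, (∑ j, hess u x i j * (gradient u x) j) ^ 2)
          + tilt u x ^ 5 * (∑ i, ∑ j, hess u x i j * (gradient u x) i * (gradient u x) j) ^ 2 ≤
        1 * (2 * (1 + 3 * m) * A x + 3 * ρ x ^ 2) + 3 * Λ ^ 2 * tilt u x := by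
      intro x hx
      simp only [hess_eq_pd_pd, gradient_apply_eq_pd]
      have h1 := one_le_tilt (hlt' x hx.1)
      have h5 := fifth_power_term_le (Q := Q x) h1 (laplacian_sq_le u x) (hρ' x hx.1)
        (lorentzMeanCurv_eq hΩ'o hu hlt' hx.1)
      have hG3 : 0 ≤ tilt u x ^ 3 * G x := mul_nonneg (by positivity) (hG0 x)
      have h6 := hA1 x hx
      change tilt u x * S x + tilt u x ^ 3 * G x + tilt u x ^ 5 * Q x ^ 2 ≤ _
      change tilt u x ^ 5 * Q x ^ 2 ≤ 3 * m * (tilt u x * S x) + _ + _ at h5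
      have h7 : 3 * m * (tilt u x * S x) ≤ 3 * m * (2 * A x) :=
        mul_le_mul_of_nonneg_left (by linarith) (by positivity)
      linarith
    refine (setLIntegral_mono' hmeas fun x hx => ENNReal.ofReal_le_ofReal (hpt x hx)).trans
      ((lintegral_mono_set hsub').trans ?_)
    refine (lintegral_ofReal_linear_combination_le hwm zero_le_one (by positivity)
      (by positivity) hPI (lintegral_ofReal_linear_combination_le hρm (by positivity)
        (by norm_num) hIJ0 (sq_nonneg I₂) hAint hρ2) hw).trans (ENNReal.ofReal_le_ofReal ?_)
    have e1 := mul_le_mul_of_nonneg_left hIJ (by positivity : (0 : ℝ) ≤ 2 * (1 + 3 * m))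
    have e2 := mul_le_mul_of_nonneg_left hPJ (by positivity : (0 : ℝ) ≤ 3 * Λ ^ 2)
    have e3 : 0 ≤ P * (I₂ ^ 2 + I₁ + 1) := by positivity
    linarith
  · have hpt : ∀ x ∈ {x ∈ Ω' | ε < Metric.infDist x (frontier Ω')},
        ‖gradient (fun y => Real.log (tilt u y)) x‖ ≤ 2 * A x + 1 * tilt u x := by
      intro x hx
      have h1 := tilt_pos (hlt' x hx.1)
      have hSx : 0 ≤ tilt u x * S x := mul_nonneg h1.le (hS0 x)
      have hGx : 0 ≤ tilt u x ^ 3 * G x := mul_nonneg (by positivity) (hG0 x)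
      have h2 : ‖gradient (fun y => Real.log (tilt u y)) x‖ ≤ tilt u x ^ 3 * G x + tilt u x := by
        refine le_of_sq_le_sq ?_ (by positivity)
        rw [norm_gradient_log_tilt_sq hΩ'o hu hlt' hx.1]
        change tilt u x ^ 4 * G x ≤ _
        have h4 : 0 ≤ tilt u x ^ 4 * G x := mul_nonneg (by positivity) (hG0 x)
        nlinarith [sq_nonneg (tilt u x ^ 3 * G x - tilt u x)]
      rw [← hA1 x hx]
      linarith
    refine (setLIntegral_mono' hmeas fun x hx => ENNReal.ofReal_le_ofReal (hpt x hx)).trans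
      ((lintegral_mono_set hsub').trans ?_)
    refine (lintegral_ofReal_linear_combination_le hwm zero_le_two zero_le_one hIJ0 hPI
      hAint hw).trans (ENNReal.ofReal_le_ofReal ?_)
    have e0 : (2 : ℝ) ≤ 2 * (1 + 3 * m) := by linarith
    have e1 := mul_le_mul e0 hIJ hIJ0 (by positivity)
    have e2 : 0 ≤ 3 * Λ ^ 2 * P * (I₂ ^ 2 + I₁ + 1) := by positivity
    have e3 : 0 ≤ I₂ ^ 2 + I₁ + 1 := by positivity
    linarith
end
end
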